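/- arXiv:2409.20404 — 4 statements merged into one kernel-verified Lean document; each statement's English description precedes it below -/
import Mathlib

section
/- (Undelayed perturbed sweeping process.) Assume (C1)–(C3) on the moving set C and let x₀ ∈ C(t₀). Then for every h ∈ L¹(I, ℝ^n), there exists a unique absolutely continuous map x : I → ℝ^n with x(t₀) = x₀, x(t) ∈ C(t) for all t ∈ I, and −ẋ(t) ∈ N^P_{C(t)}(x(t)) + h(t) for a.e. t ∈ I; moreover, this solution satisfies ‖ẋ(t) + h(t)‖ ≤ ‖h(t)‖ + |v̇(t)| for a.e. t ∈ I, where v̇ is the derivative of the function v from (C2). -/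
open MeasureTheory Set
open scoped RealInnerProductSpace

noncomputable section

/-- The proximal normal cone to a set `S` at a point `x` (empty when `x ∉ S`). -/
def proxNormalCone {n : ℕ} (S : Set (EuclideanSpace ℝ (Fin n)))
    (x : EuclideanSpace ℝ (Fin n)) : Set (EuclideanSpace ℝ (Fin n)) :=
  {v | x ∈ S ∧ ∃ σ : ℝ, 0 ≤ σ ∧ ∀ y ∈ S, ⟪v, y - x⟫ ≤ σ * ‖y - x‖ ^ 2}

/-- `S` is (uniformly) `r`-prox-regular. -/
def ProxRegular {n : ℕ} (r : ℝ) (S : Set (EuclideanSpace ℝ (Fin n))) : Prop :=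
  ∀ x ∈ S, ∀ ζ ∈ proxNormalCone S x, ∀ y ∈ S,
    ⟪ζ, y - x⟫ ≤ (1 / (2 * r)) * ‖y - x‖ ^ 2

/-- A solution of the undelayed perturbed sweeping process: `x` absolutely
continuous on `[t₀, T]` with density `x'`, starting at `x₀`, staying in the
moving set and satisfying `-ẋ(t) ∈ N^P_{C(t)}(x(t)) + h(t)` a.e. -/
def IsSweepingSolution {n : ℕ} (t₀ T : ℝ)
    (C : ℝ → Set (EuclideanSpace ℝ (Fin n)))
    (h : ℝ → EuclideanSpace ℝ (Fin n))
    (x₀ : EuclideanSpace ℝ (Fin n))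
    (x x' : ℝ → EuclideanSpace ℝ (Fin n)) : Prop :=
  IntervalIntegrable x' volume t₀ T ∧
  (∀ t ∈ Icc t₀ T, x t = x t₀ + ∫ s in t₀..t, x' s) ∧
  x t₀ = x₀ ∧
  (∀ t ∈ Icc t₀ T, x t ∈ C t) ∧
  (∀ᵐ t ∂volume, t ∈ Icc t₀ T → -x' t - h t ∈ proxNormalCone (C t) (x t))


theorem ac_of_dominated {X : Type*} [PseudoMetricSpace X] {a b : ℝ} (hab : a ≤ b) {f : ℝ → X} {V : ℝ → ℝ}
    (hV : AbsolutelyContinuousOnInterval V a b)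
    (hf : ∀ s ∈ Icc a b, ∀ t ∈ Icc a b, s ≤ t → dist (f s) (f t) ≤ V t - V s) :
    AbsolutelyContinuousOnInterval f a b := by
  have hd : ∀ s ∈ Icc a b, ∀ t ∈ Icc a b, dist (f s) (f t) ≤ dist (V s) (V t) := by
    intro s hs t ht
    rcases le_total s t with h | h
    · rw [dist_comm (V s), Real.dist_eq]
      exact (hf s hs t ht h).trans (le_abs_self _)
    · rw [dist_comm, Real.dist_eq]
      exact (hf t ht s hs h).trans (le_abs_self _)
  unfold AbsolutelyContinuousOnInterval at hV ⊢
  refine squeeze_zero' (Filter.Eventually.of_forall fun E => Finset.sum_nonneg fun i _ => dist_nonneg)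
    ?_ hV
  refine Filter.Eventually.filter_mono inf_le_right ?_
  rw [Filter.eventually_principal]
  intro E hE
  refine Finset.sum_le_sum fun i hi => ?_
  have := hE.1 i hi
  rw [uIcc_of_le hab] at this
  exact hd _ this.1 _ this.2

theorem ftc_euclidean {n : ℕ} {a b : ℝ} (hab : a ≤ b) {f : ℝ → EuclideanSpace ℝ (Fin n)} {V : ℝ → ℝ}
    (hV : AbsolutelyContinuousOnInterval V a b)
    (hf : ∀ s ∈ Icc a b, ∀ t ∈ Icc a b, s ≤ t → dist (f s) (f t) ≤ V t - V s) :
    ∃ f' : ℝ → EuclideanSpace ℝ (Fin n), IntervalIntegrable f' volume a b ∧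
      (∀ t ∈ Icc a b, f t = f a + ∫ s in a..t, f' s) ∧
      ∀ᵐ t, t ∈ Icc a b → HasDerivAt f (f' t) t := by
  let e := EuclideanSpace.basisFun (Fin n) ℝ
  have hac : ∀ i, AbsolutelyContinuousOnInterval (fun t => f t i) a b := by
    intro i
    refine ac_of_dominated hab hV fun s hs t ht hst => le_trans ?_ (hf s hs t ht hst)
    rw [dist_eq_norm, dist_eq_norm]
    exact PiLp.norm_apply_le (f s - f t) i
  have hsum : ∀ t, f t = ∑ i, f t i • e i := fun t => by
    simpa [e] using (e.sum_repr (f t)).symm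
  refine ⟨fun t => ∑ i, deriv (fun s => f s i) t • e i, ?_, ?_, ?_⟩
  · have : (fun t => ∑ i, deriv (fun s => f s i) t • e i) = ∑ i, fun t => deriv (fun s => f s i) t • e i := by
      ext1 t; simp
    rw [this]
    refine IntervalIntegrable.sum _ fun i _ => ?_
    exact ⟨(hac i).intervalIntegrable_deriv.1.smul_const _, (hac i).intervalIntegrable_deriv.2.smul_const _⟩
  · intro t ht
    have hact : ∀ i, AbsolutelyContinuousOnInterval (fun t => f t i) a t := fun i =>
      (hac i).mono (by rw [uIcc_of_le hab, uIcc_of_le ht.1]; exact Icc_subset_Icc_right ht.2)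
    rw [intervalIntegral.integral_finsetSum]
    · simp_rw [intervalIntegral.integral_smul_const, (hact _).integral_deriv_eq_sub, sub_smul]
      rw [Finset.sum_sub_distrib, ← hsum, ← hsum]; abel
    · intro i _
      exact ⟨(hact i).intervalIntegrable_deriv.1.smul_const _, (hact i).intervalIntegrable_deriv.2.smul_const _⟩
  · have : ∀ᵐ t, ∀ i, t ∈ uIcc a b → DifferentiableAt ℝ (fun s => f s i) t :=
      ae_all_iff.2 fun i => (hac i).ae_differentiableAt
    filter_upwards [this] with t ht htab
    rw [uIcc_of_le hab] at ht
    have h1 : HasDerivAt (fun t => ∑ i, f t i • e i) (∑ i, deriv (fun s => f s i) t • e i) t :=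
      HasDerivAt.fun_sum fun i _ => ((ht i htab).hasDerivAt).smul_const (e i)
    rwa [show (fun t => ∑ i, f t i • e i) = f from funext fun t => (hsum t).symm] at h1

theorem eq_zero_of_inner_nonpos {E : Type*} [NormedAddCommGroup E] [InnerProductSpace ℝ E] [CompleteSpace E]
    {a b : ℝ} (hab : a ≤ b) {w' : ℝ → E} (hw : IntervalIntegrable w' volume a b)
    (hin : ∀ᵐ t, t ∈ Icc a b → ⟪∫ s in a..t, w' s, w' t⟫ ≤ 0) :
    ∀ t ∈ Icc a b, ∫ s in a..t, w' s = 0 := by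
  set W : ℝ → E := fun t => ∫ s in a..t, w' s with hW
  have hsub : ∀ t ∈ Icc a b, IntervalIntegrable w' volume a t := fun t ht =>
    hw.mono_set (by rw [uIcc_of_le hab, uIcc_of_le ht.1]; exact Icc_subset_Icc_right ht.2)
  have hV := hw.norm.absolutelyContinuousOnInterval_intervalIntegral (c := a) left_mem_uIcc
  have hN : AbsolutelyContinuousOnInterval (fun t => ‖W t‖) a b := by
    refine ac_of_dominated hab hV fun s hs t ht hst => ?_
    rw [intervalIntegral.integral_interval_sub_left (hsub t ht).norm (hsub s hs).norm]
    calc dist ‖W s‖ ‖W t‖ ≤ dist (W s) (W t) := (dist_norm_norm_le _ _).trans_eq (dist_eq_norm _ _).symm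
      _ = ‖∫ u in s..t, w' u‖ := by
        rw [dist_comm, dist_eq_norm, hW, intervalIntegral.integral_interval_sub_left (hsub t ht) (hsub s hs)]
      _ ≤ _ := intervalIntegral.norm_integral_le_integral_norm hst
  have hac := hN.mul hN
  have hder := hw.ae_hasDerivAt_integral
  rw [uIcc_of_le hab] at hder
  intro t ht
  have hact := hac.mono (c := a) (d := t) (by rw [uIcc_of_le hab, uIcc_of_le ht.1]; exact Icc_subset_Icc_right ht.2)
  have h1 := hact.integral_deriv_eq_sub
  have h2 : 0 ≤ ∫ s in a..t, - deriv ((fun t => ‖W t‖) * (fun t => ‖W t‖)) s := by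
    refine intervalIntegral.integral_nonneg_of_ae_restrict ht.1 ?_
    rw [Filter.EventuallyLE, ae_restrict_iff' measurableSet_Icc]
    filter_upwards [hder, hin] with s hs1 hs2 hs
    have hs' : s ∈ Icc a b := ⟨hs.1, hs.2.trans ht.2⟩
    have hd : HasDerivAt W (w' s) s := hs1 hs' a (left_mem_Icc.2 hab)
    have := hd.norm_sq
    have h3 : ((fun t => ‖W t‖) * (fun t => ‖W t‖)) = fun t => ‖W t‖ ^ 2 := by
      ext t; simp [sq]
    have h4 := hs2 hs'
    rw [h3, this.deriv]
    simp only [Pi.zero_apply]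
    linarith
  rw [intervalIntegral.integral_neg, h1] at h2
  have h0 : W a = 0 := by simp [hW]
  simp only [Pi.mul_apply, h0] at h2
  have : ‖W t‖ * ‖W t‖ = 0 := le_antisymm (by simpa using h2) (by positivity)
  simpa using this
/-- catching-up scheme on a finite set of times -/
theorem finite_scheme {E : Type*} [NormedAddCommGroup E] [InnerProductSpace ℝ E]
    {a b : ℝ} {D : ℝ → Set E} {V : ℝ → ℝ}
    (hproj : ∀ t ∈ Icc a b, ∀ z, ∃ p ∈ D t, ∀ w ∈ D t, ⟪z - p, w - p⟫ ≤ 0)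
    (hmove : ∀ s ∈ Icc a b, ∀ t ∈ Icc a b, s ≤ t →
      (∀ z ∈ D s, ∃ w ∈ D t, ‖z - w‖ ≤ V t - V s) ∧ (∀ z ∈ D t, ∃ w ∈ D s, ‖z - w‖ ≤ V t - V s))
    {x₀ : E} (hx₀ : x₀ ∈ D a) (F : Finset ℝ) :
    (∀ t ∈ F, t ∈ Icc a b) → ∃ y : ℝ → E, (a ∈ F → y a = x₀) ∧ (∀ t ∈ F, y t ∈ D t) ∧
      (∀ s ∈ F, ∀ t ∈ F, s ≤ t → ‖y t - y s‖ ≤ V t - V s ∧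
        ∀ z ∈ D t, ‖y t - z‖ ^ 2 ≤ ‖y s - z‖ ^ 2 + 2 * (V t - V s) ^ 2) := by
  induction F using Finset.induction_on_max with
  | empty => intro _; exact ⟨fun _ => x₀, by simp⟩
  | insert c F hc ih =>
    intro hF
    have hcI : c ∈ Icc a b := hF c (Finset.mem_insert_self _ _)
    have hFI : ∀ t ∈ F, t ∈ Icc a b := fun t ht => hF t (Finset.mem_insert_of_mem ht)
    obtain ⟨y, hy0, hyD, hyE⟩ := ih hFI
    rcases F.eq_empty_or_nonempty with rfl | hne
    · obtain ⟨p, hp, -⟩ := hproj c hcI x₀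
      by_cases hca : c = a
      · refine ⟨fun _ => x₀, ?_⟩
        subst hca
        simp [hx₀]
      · refine ⟨fun _ => p, ?_⟩
        simp [hp, Ne.symm hca]
    · set m := F.max' hne with hm
      have hmF : m ∈ F := F.max'_mem hne
      have hmle : ∀ s ∈ F, s ≤ m := fun s hs => F.le_max' s hs
      have hmc : m < c := hc m hmF
      have hmI := hFI m hmF
      obtain ⟨p, hp, hpn⟩ := hproj c hcI (y m)
      obtain ⟨q, hq, hqn⟩ := (hmove m hmI c hcI hmc.le).1 (y m) (hyD m hmF)
      -- general projection inequality
      have hpz : ∀ z ∈ D c, ‖p - z‖ ^ 2 + ‖y m - p‖ ^ 2 ≤ ‖y m - z‖ ^ 2 := by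
        intro z hz
        have h1 := hpn z hz
        have h2 : y m - z = (y m - p) - (z - p) := by abel
        rw [h2, norm_sub_sq_real (y m - p), norm_sub_rev p z]
        linarith
      have hpm : ‖p - y m‖ ≤ V c - V m := by
        have h1 := hpz q hq
        have h2 : ‖y m - p‖ ≤ ‖y m - q‖ := by
          refine (sq_le_sq₀ (norm_nonneg _) (norm_nonneg _)).1 ?_
          nlinarith [sq_nonneg ‖p - q‖]
        rw [norm_sub_rev]; exact h2.trans hqn
      have hstep : ∀ s ∈ F, ‖p - y s‖ ≤ V c - V s ∧
          ∀ z ∈ D c, ‖p - z‖ ^ 2 ≤ ‖y s - z‖ ^ 2 + 2 * (V c - V s) ^ 2 := by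
        intro s hs
        obtain ⟨h1, h2⟩ := hyE s hs m hmF (hmle s hs)
        refine ⟨?_, fun z hz => ?_⟩
        · have h3 : p - y s = (p - y m) + (y m - y s) := by abel
          rw [h3]
          exact (norm_add_le _ _).trans (by linarith)
        · obtain ⟨z', hz', hzz⟩ := (hmove m hmI c hcI hmc.le).2 z hz
          have h3 := h2 z' hz'
          have h4 := hpz z hz
          have h5 : ‖y m - z‖ ^ 2 - ‖y s - z‖ ^ 2
              = ‖y m - z'‖ ^ 2 - ‖y s - z'‖ ^ 2 - 2 * ⟪y m - y s, z - z'⟫ := by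
            simp only [norm_sub_sq_real, inner_sub_left, inner_sub_right]; ring
          have h6 := abs_real_inner_le_norm (y m - y s) (z - z')
          have h7 : ‖y m - y s‖ * ‖z - z'‖ ≤ (V m - V s) * (V c - V m) :=
            mul_le_mul h1 hzz (norm_nonneg _) ((norm_nonneg _).trans h1)
          have h8 := neg_abs_le ⟪y m - y s, z - z'⟫
          have h9 : 0 ≤ V m - V s := (norm_nonneg _).trans h1
          have h10 : 0 ≤ V c - V m := (norm_nonneg _).trans hzz
          nlinarith [sq_nonneg ‖y m - p‖, mul_nonneg h9 h10, sq_nonneg (V c - V m)]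
      have hne' : ∀ s ∈ F, s ≠ c := fun s hs => (hc s hs).ne
      refine ⟨Function.update y c p, ?_, ?_, ?_⟩
      · intro ha
        have hca : a ≠ c := (hmI.1.trans_lt hmc).ne
        rw [Function.update_of_ne hca]
        exact hy0 (Finset.mem_of_mem_insert_of_ne ha hca)
      · intro t ht
        rcases Finset.mem_insert.1 ht with rfl | ht
        · simpa using hp
        · rw [Function.update_of_ne (hne' t ht)]; exact hyD t ht
      · intro s hs t ht hst
        rcases Finset.mem_insert.1 ht with rfl | ht
        · rcases Finset.mem_insert.1 hs with rfl | hs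
          · simp
          · rw [Function.update_of_ne (hne' s hs), Function.update_self]
            exact hstep s hs
        · rcases Finset.mem_insert.1 hs with rfl | hs
          · rename_i htF
            exact absurd (hc t htF) (not_lt.2 hst)
          · rw [Function.update_of_ne (hne' s hs), Function.update_of_ne (hne' t ht)]
            exact hyE s hs t ht hst

theorem limit_scheme {E : Type*} [NormedAddCommGroup E] [InnerProductSpace ℝ E] [ProperSpace E]
    {a b : ℝ} (hab : a ≤ b) {D : ℝ → Set E} {V : ℝ → ℝ}
    (hclosed : ∀ t ∈ Icc a b, IsClosed (D t))
    (hproj : ∀ t ∈ Icc a b, ∀ z, ∃ p ∈ D t, ∀ w ∈ D t, ⟪z - p, w - p⟫ ≤ 0)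
    (hmove : ∀ s ∈ Icc a b, ∀ t ∈ Icc a b, s ≤ t →
      (∀ z ∈ D s, ∃ w ∈ D t, ‖z - w‖ ≤ V t - V s) ∧ (∀ z ∈ D t, ∃ w ∈ D s, ‖z - w‖ ≤ V t - V s))
    {x₀ : E} (hx₀ : x₀ ∈ D a) :
    ∃ y : ℝ → E, y a = x₀ ∧ (∀ t ∈ Icc a b, y t ∈ D t) ∧
      (∀ s ∈ Icc a b, ∀ t ∈ Icc a b, s ≤ t → ‖y t - y s‖ ≤ V t - V s ∧
        ∀ z ∈ D t, ‖y t - z‖ ^ 2 ≤ ‖y s - z‖ ^ 2 + 2 * (V t - V s) ^ 2) := by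
  classical
  have hex := fun F : Finset (Icc a b) => finite_scheme hproj hmove hx₀ (F.image Subtype.val)
    (by intro t ht; obtain ⟨u, -, rfl⟩ := Finset.mem_image.1 ht; exact u.2)
  choose Y hY0 hYD hYE using hex
  let U : Ultrafilter (Finset (Icc a b)) := Ultrafilter.of Filter.atTop
  have hU : ∀ t : Icc a b, ∀ᶠ F in (U : Filter (Finset (Icc a b))), (t : ℝ) ∈ F.image Subtype.val := by
    intro t
    refine Filter.Eventually.filter_mono (Ultrafilter.of_le _) ?_
    filter_upwards [Filter.eventually_ge_atTop {t}] with F hF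
    exact Finset.mem_image_of_mem _ (hF (Finset.mem_singleton_self t))
  have haI : a ∈ Icc a b := left_mem_Icc.2 hab
  have hlim : ∀ t : Icc a b, ∃ z, Filter.Tendsto (fun F => Y F t) U (nhds z) := by
    intro t
    have hK : IsCompact (Metric.closedBall x₀ (V t - V a)) := isCompact_closedBall _ _
    obtain ⟨z, -, hz⟩ := hK.ultrafilter_le_nhds (U.map (fun F => Y F t)) (by
      rw [Filter.le_principal_iff, Ultrafilter.mem_coe, Ultrafilter.mem_map]
      show ∀ᶠ F in (U : Filter (Finset (Icc a b))), Y F t ∈ Metric.closedBall x₀ (V t - V a)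
      filter_upwards [hU t, hU ⟨a, haI⟩] with F h1 h2
      have := (hYE F a h2 t h1 t.2.1).1
      rw [hY0 F h2] at this
      simpa [dist_eq_norm] using this)
    exact ⟨z, hz⟩
  choose z hz using hlim
  let y : ℝ → E := fun t => if ht : t ∈ Icc a b then z ⟨t, ht⟩ else 0
  have hy : ∀ t ∈ Icc a b, Filter.Tendsto (fun F => Y F t) U (nhds (y t)) := by
    intro t ht
    simp only [y, dif_pos ht]
    exact hz ⟨t, ht⟩
  refine ⟨y, ?_, ?_, ?_⟩
  · refine tendsto_nhds_unique (hy a haI) (tendsto_const_nhds.congr' ?_)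
    filter_upwards [hU ⟨a, haI⟩] with F hF
    exact (hY0 F hF).symm
  · intro t ht
    refine (hclosed t ht).mem_of_tendsto (hy t ht) ?_
    filter_upwards [hU ⟨t, ht⟩] with F hF
    exact hYD F t hF
  · intro s hs t ht hst
    refine ⟨le_of_tendsto ((hy t ht).sub (hy s hs)).norm ?_, fun w hw => ?_⟩
    · filter_upwards [hU ⟨t, ht⟩, hU ⟨s, hs⟩] with F h1 h2
      exact (hYE F s h2 t h1 hst).1
    · refine le_of_tendsto_of_tendsto (((hy t ht).sub_const w).norm.pow 2)
        ((((hy s hs).sub_const w).norm.pow 2).add_const _) ?_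
      filter_upwards [hU ⟨t, ht⟩, hU ⟨s, hs⟩] with F h1 h2
      exact (hYE F s h2 t h1 hst).2 w hw

theorem Iio_subset_compl (t : ℝ) : Iio t ⊆ {t}ᶜ := fun _ hs => ne_of_lt hs

theorem left_deriv_norm_le {E : Type*} [NormedAddCommGroup E] [NormedSpace ℝ E] {a t : ℝ} (hat : a < t)
    {y : ℝ → E} {y' : E} {V : ℝ → ℝ} {g : ℝ} (hy : HasDerivAt y y' t) (hV : HasDerivAt V g t)
    (h : ∀ s ∈ Icc a t, ‖y t - y s‖ ≤ V t - V s) : ‖y'‖ ≤ g := by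
  have h1 := (hasDerivAt_iff_tendsto_slope.1 hy).mono_left
    (nhdsWithin_mono t (Iio_subset_compl t))
  have h2 := (hasDerivAt_iff_tendsto_slope.1 hV).mono_left
    (nhdsWithin_mono t (Iio_subset_compl t))
  refine le_of_tendsto_of_tendsto h1.norm h2 ?_
  filter_upwards [Ioo_mem_nhdsLT hat] with s hs
  have h3 := h s ⟨hs.1.le, hs.2.le⟩
  have h4 : 0 < t - s := sub_pos.2 hs.2
  rw [slope_comm, slope_comm V, slope_def_module, slope_def_module, norm_smul, norm_inv, Real.norm_of_nonneg h4.le,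
    smul_eq_mul]
  gcongr

theorem left_deriv_inner_le {E : Type*} [NormedAddCommGroup E] [InnerProductSpace ℝ E] {a t : ℝ} (hat : a < t)
    {y : ℝ → E} {y' : E} {V : ℝ → ℝ} {g : ℝ} (hy : HasDerivAt y y' t) (hV : HasDerivAt V g t) (z : E)
    (h : ∀ s ∈ Icc a t, ‖y t - z‖ ^ 2 ≤ ‖y s - z‖ ^ 2 + 2 * (V t - V s) ^ 2) : ⟪y t - z, y'⟫ ≤ 0 := by
  have hd : HasDerivAt (fun s => ‖y s - z‖ ^ 2 + 2 * (V t - V s) ^ 2)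
      (2 * ⟪y t - z, y'⟫ + 2 * (2 * (V t - V t) * (-g))) t := by
    have := (hy.sub_const z).norm_sq.add (((hV.const_sub (V t)).pow 2).const_mul 2)
    refine this.congr_deriv ?_
    simp
  have h1 := (hasDerivAt_iff_tendsto_slope.1 hd).mono_left
    (nhdsWithin_mono t (Iio_subset_compl t))
  have h2 : 2 * ⟪y t - z, y'⟫ + 2 * (2 * (V t - V t) * (-g)) ≤ 0 := by
    refine le_of_tendsto h1 ?_
    filter_upwards [Ioo_mem_nhdsLT hat] with s hs
    have h3 := h s ⟨hs.1.le, hs.2.le⟩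
    rw [slope_def_field]
    refine div_nonpos_of_nonneg_of_nonpos ?_ (sub_nonpos.2 hs.2.le)
    simp only [sub_self]
    linarith
  simp only [sub_self] at h2
  linarith

theorem proxRegular_inner_nonpos {n : ℕ} {r : ℝ} (hr : 0 < r) {S : Set (EuclideanSpace ℝ (Fin n))}
    (hS : ProxRegular r S) {x ζ : EuclideanSpace ℝ (Fin n)} (hζ : ζ ∈ proxNormalCone S x)
    {y : EuclideanSpace ℝ (Fin n)} (hy : y ∈ S) : ⟪ζ, y - x⟫ ≤ 0 := by
  obtain ⟨hx, σ, hσ, h⟩ := hζ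
  by_contra hpos
  push Not at hpos
  set p := ⟪ζ, y - x⟫ with hp
  set K := (1 / (2 * r)) * ‖y - x‖ ^ 2 with hK
  have hK0 : 0 ≤ K := by positivity
  set l := (K + 1) / p with hl
  have hl0 : 0 ≤ l := by positivity
  have h1 := hS x hx (l • ζ) ⟨hx, l * σ, by positivity, fun w hw => by
    rw [real_inner_smul_left, mul_assoc]
    exact mul_le_mul_of_nonneg_left (h w hw) hl0⟩ y hy
  rw [real_inner_smul_left, ← hp, hl, div_mul_cancel₀ _ hpos.ne', ← hK] at h1
  linarith

theorem proxRegular_exists_proj {n : ℕ} {r : ℝ} (hr : 0 < r) {S : Set (EuclideanSpace ℝ (Fin n))}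
    (hS : ProxRegular r S) (hne : S.Nonempty) (hcl : IsClosed S) (z : EuclideanSpace ℝ (Fin n)) :
    ∃ p ∈ S, ‖z - p‖ = Metric.infDist z S ∧ ∀ w ∈ S, ⟪z - p, w - p⟫ ≤ 0 := by
  obtain ⟨p, hp, hd⟩ := hcl.exists_infDist_eq_dist hne z
  refine ⟨p, hp, by rw [hd, dist_eq_norm], fun w hw => ?_⟩
  refine proxRegular_inner_nonpos hr hS ⟨hp, 1 / 2, by norm_num, fun y hy => ?_⟩ hw
  have h1 : ‖z - p‖ ≤ ‖z - y‖ := by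
    rw [← dist_eq_norm, ← dist_eq_norm, ← hd]
    exact Metric.infDist_le_dist_of_mem hy
  have h2 : ‖z - p‖ ^ 2 ≤ ‖z - y‖ ^ 2 := by gcongr
  have h3 : z - y = (z - p) - (y - p) := by abel
  rw [h3, norm_sub_sq_real (z - p)] at h2
  linarith

theorem sweeping_unique {n : ℕ} {t₀ T r : ℝ} (hr : 0 < r) (hT : t₀ ≤ T)
    {C : ℝ → Set (EuclideanSpace ℝ (Fin n))} {h : ℝ → EuclideanSpace ℝ (Fin n)}
    (hC3 : ∀ t ∈ Icc t₀ T, ProxRegular r (C t))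
    {x₀ : EuclideanSpace ℝ (Fin n)} {x x' : ℝ → EuclideanSpace ℝ (Fin n)}
    (hx : IsSweepingSolution t₀ T C h x₀ x x') (y y' : ℝ → EuclideanSpace ℝ (Fin n))
    (hy : IsSweepingSolution t₀ T C h x₀ y y') : ∀ t ∈ Icc t₀ T, y t = x t := by
  obtain ⟨hx1, hx2, hx3, hx4, hx5⟩ := hx
  obtain ⟨hy1, hy2, hy3, hy4, hy5⟩ := hy
  have hsub : ∀ t ∈ Icc t₀ T, uIcc t₀ t ⊆ uIcc t₀ T := fun t ht => by
    rw [uIcc_of_le hT, uIcc_of_le ht.1]; exact Icc_subset_Icc_right ht.2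
  have hw : ∀ t ∈ Icc t₀ T, ∫ s in t₀..t, (y' s - x' s) = y t - x t := by
    intro t ht
    rw [intervalIntegral.integral_sub (hy1.mono_set (hsub t ht)) (hx1.mono_set (hsub t ht)),
      hy2 t ht, hx2 t ht, hx3, hy3]
    abel
  have h0 := eq_zero_of_inner_nonpos hT (hy1.sub hx1) (by
    filter_upwards [hx5, hy5] with t h1 h2 ht
    have e1 := proxRegular_inner_nonpos hr (hC3 t ht) (h1 ht) (hy4 t ht)
    have e2 := proxRegular_inner_nonpos hr (hC3 t ht) (h2 ht) (hx4 t ht)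
    rw [hw t ht, real_inner_comm]
    have e3 : y' t - x' t = (-x' t - h t) - (-y' t - h t) := by abel
    have e4 : x t - y t = -(y t - x t) := by abel
    rw [e4, inner_neg_right] at e2
    rw [e3, inner_sub_left]
    linarith)
  intro t ht
  have := h0 t ht
  rw [hw t ht] at this
  exact sub_eq_zero.1 this

/-- existence, uniqueness, and the velocity estimate for the
undelayed perturbed sweeping process. -/
theorem stmt3 {n : ℕ} (t₀ T : ℝ) (ht₀ : 0 ≤ t₀) (hT : t₀ < T)
    (C : ℝ → Set (EuclideanSpace ℝ (Fin n)))
    (r : ℝ) (hr : 0 < r)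
    (v v' : ℝ → ℝ)
    -- (C1)
    (hC1 : ∀ t ∈ Icc t₀ T, (C t).Nonempty ∧ IsClosed (C t))
    -- (C2)
    (hv'int : IntervalIntegrable v' volume t₀ T)
    (hvAC : ∀ t ∈ Icc t₀ T, v t = v t₀ + ∫ s in t₀..t, v' s)
    (hC2 : ∀ y : EuclideanSpace ℝ (Fin n), ∀ s ∈ Icc t₀ T, ∀ t ∈ Icc t₀ T,
      |Metric.infDist y (C t) - Metric.infDist y (C s)| ≤ |v t - v s|)
    -- (C3)
    (hC3 : ∀ t ∈ Icc t₀ T, ProxRegular r (C t))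
    -- data
    (x₀ : EuclideanSpace ℝ (Fin n)) (hx₀ : x₀ ∈ C t₀)
    (h : ℝ → EuclideanSpace ℝ (Fin n))
    (hh : IntegrableOn h (Icc t₀ T) volume) :
    ∃ x x' : ℝ → EuclideanSpace ℝ (Fin n),
      IsSweepingSolution t₀ T C h x₀ x x' ∧
      -- the velocity estimate
      (∀ᵐ t ∂volume, t ∈ Icc t₀ T → ‖x' t + h t‖ ≤ ‖h t‖ + |v' t|) ∧
      -- uniqueness
      (∀ y y' : ℝ → EuclideanSpace ℝ (Fin n),
        IsSweepingSolution t₀ T C h x₀ y y' → ∀ t ∈ Icc t₀ T, y t = x t) := by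
  have hTle := hT.le
  have hhI : IntervalIntegrable h volume t₀ T :=
    (intervalIntegrable_iff_integrableOn_Icc_of_le hTle).2 hh
  have hsub : ∀ t ∈ Icc t₀ T, uIcc t₀ t ⊆ uIcc t₀ T := fun t ht => by
    rw [uIcc_of_le hTle, uIcc_of_le ht.1]; exact Icc_subset_Icc_right ht.2
  let g : ℝ → ℝ := fun t => ‖h t‖ + |v' t|
  have hg : IntervalIntegrable g volume t₀ T := hhI.norm.add hv'int.abs
  let H : ℝ → EuclideanSpace ℝ (Fin n) := fun t => ∫ s in t₀..t, h s
  let V : ℝ → ℝ := fun t => ∫ s in t₀..t, g s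
  have hVac : AbsolutelyContinuousOnInterval V t₀ T :=
    hg.absolutelyContinuousOnInterval_intervalIntegral left_mem_uIcc
  have hVbd : ∀ s ∈ Icc t₀ T, ∀ t ∈ Icc t₀ T, s ≤ t →
      |v t - v s| + ‖H t - H s‖ ≤ V t - V s := by
    intro s hs t ht hst
    have i1 : ∀ t ∈ Icc t₀ T, IntervalIntegrable h volume t₀ t := fun t ht => hhI.mono_set (hsub t ht)
    have i2 : ∀ t ∈ Icc t₀ T, IntervalIntegrable v' volume t₀ t := fun t ht => hv'int.mono_set (hsub t ht)
    have i3 : ∀ t ∈ Icc t₀ T, IntervalIntegrable g volume t₀ t := fun t ht => hg.mono_set (hsub t ht)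
    have e1 : H t - H s = ∫ u in s..t, h u :=
      intervalIntegral.integral_interval_sub_left (i1 t ht) (i1 s hs)
    have e3 : V t - V s = ∫ u in s..t, g u :=
      intervalIntegral.integral_interval_sub_left (i3 t ht) (i3 s hs)
    have e2 : v t - v s = ∫ u in s..t, v' u := by
      rw [hvAC t ht, hvAC s hs, add_sub_add_left_eq_sub]
      exact intervalIntegral.integral_interval_sub_left (i2 t ht) (i2 s hs)
    have j1 : IntervalIntegrable h volume s t := (i1 s hs).symm.trans (i1 t ht)
    have j2 : IntervalIntegrable v' volume s t := (i2 s hs).symm.trans (i2 t ht)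
    rw [e1, e2, e3, intervalIntegral.integral_add j1.norm j2.abs, add_comm]
    exact add_le_add (intervalIntegral.norm_integral_le_integral_norm hst)
      (intervalIntegral.abs_integral_le_integral_abs hst)
  have hproj := fun t ht => proxRegular_exists_proj hr (hC3 t ht) (hC1 t ht).1 (hC1 t ht).2
  have hCmove : ∀ s ∈ Icc t₀ T, ∀ t ∈ Icc t₀ T, ∀ z ∈ C s, ∃ w ∈ C t, ‖z - w‖ ≤ |v t - v s| := by
    intro s hs t ht z hz
    obtain ⟨p, hp, hd, -⟩ := hproj t ht z
    refine ⟨p, hp, ?_⟩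
    have := hC2 z s hs t ht
    rw [Metric.infDist_zero_of_mem hz, sub_zero, ← hd] at this
    exact (le_abs_self _).trans this
  -- the translated moving set
  let D : ℝ → Set (EuclideanSpace ℝ (Fin n)) := fun t => {z | z - H t ∈ C t}
  have hDmove : ∀ s ∈ Icc t₀ T, ∀ t ∈ Icc t₀ T, ∀ z ∈ D s, ∃ w ∈ D t,
      ‖z - w‖ ≤ |v t - v s| + ‖H t - H s‖ := by
    intro s hs t ht z hz
    obtain ⟨w, hw, hd⟩ := hCmove s hs t ht _ hz
    refine ⟨w + H t, by simpa [D] using hw, ?_⟩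
    have : z - (w + H t) = (z - H s - w) - (H t - H s) := by abel
    rw [this]
    exact (norm_sub_le _ _).trans (add_le_add_left hd _)
  have hH0 : H t₀ = 0 := by simp [H]
  have ht₀I : t₀ ∈ Icc t₀ T := left_mem_Icc.2 hTle
  obtain ⟨y, hy0, hyD, hyE⟩ := limit_scheme (x₀ := x₀) (D := D) (V := V) hTle
    (fun t ht => (hC1 t ht).2.preimage (by fun_prop : Continuous fun z => z - H t))
    (fun t ht z => by
      obtain ⟨p, hp, -, hin⟩ := hproj t ht (z - H t)
      refine ⟨p + H t, by simpa [D] using hp, fun w hw => ?_⟩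
      have := hin _ hw
      rwa [sub_sub, sub_sub, add_comm (H t)] at this)
    (fun s hs t ht hst => ⟨fun z hz => by
        obtain ⟨w, hw, hd⟩ := hDmove s hs t ht z hz
        exact ⟨w, hw, hd.trans (hVbd s hs t ht hst)⟩,
      fun z hz => by
        obtain ⟨w, hw, hd⟩ := hDmove t ht s hs z hz
        rw [abs_sub_comm, norm_sub_rev (H s)] at hd
        exact ⟨w, hw, hd.trans (hVbd s hs t ht hst)⟩⟩)
    (by simpa [D, hH0] using hx₀)
  obtain ⟨y', hy'I, hyint, hyder⟩ := ftc_euclidean (f := y) hTle hVac (fun s hs t ht hst => by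
    rw [dist_comm, dist_eq_norm]; exact (hyE s hs t ht hst).1)
  have hVder := hg.ae_hasDerivAt_integral
  rw [uIcc_of_le hTle] at hVder
  have hne : ∀ᵐ t : ℝ, t ≠ t₀ := by simp [ae_iff, measure_singleton]
  have hkey : ∀ᵐ t, t ∈ Icc t₀ T → ‖y' t‖ ≤ g t ∧ ∀ z ∈ D t, ⟪y t - z, y' t⟫ ≤ 0 := by
    filter_upwards [hyder, hVder, hne] with t h1 h2 h3 ht
    have hlt : t₀ < t := lt_of_le_of_ne ht.1 (Ne.symm h3)
    have hsT : ∀ s ∈ Icc t₀ t, s ∈ Icc t₀ T := fun s hs => ⟨hs.1, hs.2.trans ht.2⟩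
    have hVt : HasDerivAt V (g t) t := h2 ht t₀ ht₀I
    exact ⟨left_deriv_norm_le hlt (h1 ht) hVt fun s hs => (hyE s (hsT s hs) t ht hs.2).1,
      fun z hz => left_deriv_inner_le hlt (h1 ht) hVt z fun s hs => (hyE s (hsT s hs) t ht hs.2).2 z hz⟩
  have hsol : IsSweepingSolution t₀ T C h x₀ (fun t => y t - H t) (fun t => y' t - h t) := by
    refine ⟨hy'I.sub hhI, fun t ht => ?_, by simp [hH0, hy0], fun t ht => hyD t ht, ?_⟩
    · rw [intervalIntegral.integral_sub (hy'I.mono_set (hsub t ht)) (hhI.mono_set (hsub t ht))]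
      simp only [hH0, hyint t ht, H]
      abel
    · filter_upwards [hkey] with t hk ht
      refine ⟨hyD t ht, 0, le_rfl, fun z hz => ?_⟩
      have h1 := (hk ht).2 (z + H t) (by simpa [D] using hz)
      have h2 : -(y' t - h t) - h t = - y' t := by abel
      have h3 : z - (y t - H t) = -(y t - (z + H t)) := by abel
      rw [h2, h3, inner_neg_neg, real_inner_comm]
      simpa using h1
  refine ⟨_, _, hsol, ?_, ?_⟩
  · filter_upwards [hkey] with t hk ht
    simpa using (hk ht).1
  · exact sweeping_unique hr hTle hC3 hsol
end
end

section
/- (Brezis lemma, equivalence part.) Let A : ℝ^n → 𝒫(ℝ^n) be a maximal monotone set-valued operator, let f : [0,T] → ℝ^n have bounded variation, and let x : [0,T] → ℝ^n be absolutely continuous with ẋ(t) ∈ −A(x(t)) + f(t) for a.e. t ∈ [0,T]. Then x(0) ∈ D(A) if and only if x is Lipschitz continuous on [0,T]; moreover, in this case x(t) ∈ D(A) for all t ∈ [0,T]. -/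
open MeasureTheory Set Filter
open scoped RealInnerProductSpace Topology

noncomputable section

/-- A set-valued operator `A` on ℝⁿ is maximal monotone. -/
def MaximalMonotone {n : ℕ}
    (A : EuclideanSpace ℝ (Fin n) → Set (EuclideanSpace ℝ (Fin n))) : Prop :=
  (∀ x y u v, u ∈ A x → v ∈ A y → 0 ≤ ⟪u - v, x - y⟫) ∧
  (∀ x u, (∀ y, ∀ v ∈ A y, 0 ≤ ⟪u - v, x - y⟫) → u ∈ A x)

lemma brezis_ac_of_dist_le {X Y : Type*} [PseudoMetricSpace X] [PseudoMetricSpace Y]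
    {G : ℝ → X} {y : ℝ → Y} {a b : ℝ} (hG : AbsolutelyContinuousOnInterval G a b)
    (h : ∀ s ∈ uIcc a b, ∀ t ∈ uIcc a b, dist (y s) (y t) ≤ dist (G s) (G t)) :
    AbsolutelyContinuousOnInterval y a b := by
  rw [absolutelyContinuousOnInterval_iff] at hG ⊢
  intro ε hε
  obtain ⟨δ, hδ, hd⟩ := hG ε hε
  refine ⟨δ, hδ, fun E hE hlt => lt_of_le_of_lt (Finset.sum_le_sum fun i hi => ?_) (hd E hE hlt)⟩
  exact h _ (hE.1 i hi).1 _ (hE.1 i hi).2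

lemma brezis_ac_norm {n : ℕ} {z : ℝ → EuclideanSpace ℝ (Fin n)} {a b : ℝ}
    (hz : AbsolutelyContinuousOnInterval z a b) :
    AbsolutelyContinuousOnInterval (fun t => ‖z t‖) a b := by
  refine brezis_ac_of_dist_le hz fun s _ t _ => ?_
  rw [dist_eq_norm (z s), Real.dist_eq]
  exact abs_norm_sub_norm_le _ _

lemma brezis_gronwall {n : ℕ} (b : ℝ) (hb : 0 ≤ b) (z z' : ℝ → EuclideanSpace ℝ (Fin n))
    (hz' : IntervalIntegrable z' volume 0 b)
    (hz : ∀ t ∈ Icc (0 : ℝ) b, z t = z 0 + ∫ s in (0 : ℝ)..t, z' s)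
    (φ : ℝ → ℝ) (hφ : IntervalIntegrable φ volume 0 b) (hφ0 : ∀ t ∈ Icc (0 : ℝ) b, 0 ≤ φ t)
    (hle : ∀ᵐ t ∂volume, t ∈ Icc (0 : ℝ) b → ⟪z' t, z t⟫ ≤ φ t * ‖z t‖) :
    ∀ t ∈ Icc (0 : ℝ) b, ‖z t‖ ≤ ‖z 0‖ + 2 * ∫ s in (0 : ℝ)..b, φ s := by
  set y : ℝ → EuclideanSpace ℝ (Fin n) := fun t => z 0 + ∫ s in (0 : ℝ)..t, z' s with hy
  have hyac : AbsolutelyContinuousOnInterval y 0 b := by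
    have h1 := hz'.norm.absolutelyContinuousOnInterval_intervalIntegral (c := 0) left_mem_uIcc
    refine brezis_ac_of_dist_le h1 fun s hs t ht => ?_
    have hi : ∀ r ∈ uIcc 0 b, IntervalIntegrable z' volume 0 r := fun r hr =>
      hz'.mono_set (uIcc_subset_uIcc_left hr)
    rw [dist_eq_norm, Real.dist_eq]
    simp only [hy, add_sub_add_left_eq_sub]
    rw [intervalIntegral.integral_interval_sub_left (hi s hs) (hi t ht),
      intervalIntegral.integral_interval_sub_left (hi s hs).norm (hi t ht).norm]
    exact intervalIntegral.norm_integral_le_abs_integral_norm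
  have hN := brezis_ac_norm hyac
  have hcont : ContinuousOn (fun t => ‖y t‖) (Icc 0 b) := by
    have := hN.continuousOn
    rwa [uIcc_of_le hb] at this
  obtain ⟨τ, hτ, hmax⟩ := isCompact_Icc.exists_isMaxOn (nonempty_Icc.2 hb) hcont
  have hN2 : AbsolutelyContinuousOnInterval (fun t => ‖y t‖ * ‖y t‖) 0 τ := by
    have h := hN.mono (c := 0) (d := τ) (by
      rw [uIcc_of_le hb, uIcc_of_le hτ.1]; exact Icc_subset_Icc le_rfl hτ.2)
    exact h.fun_mul h
  have hint := hN2.integral_deriv_eq_sub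
  have hφτ : IntervalIntegrable φ volume 0 τ := hφ.mono_set (by
      rw [uIcc_of_le hb, uIcc_of_le hτ.1]; exact Icc_subset_Icc le_rfl hτ.2)
  have hφτb : IntervalIntegrable φ volume τ b := hφ.mono_set (by
      rw [uIcc_of_le hb, uIcc_of_le hτ.2]; exact Icc_subset_Icc hτ.1 le_rfl)
  have hdle : ∫ s in (0:ℝ)..τ, deriv (fun t => ‖y t‖ * ‖y t‖) s
      ≤ ∫ s in (0:ℝ)..τ, (2 * ‖y τ‖) * φ s := by
    apply intervalIntegral.integral_mono_ae_restrict hτ.1 hN2.intervalIntegrable_deriv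
      (hφτ.const_mul _)
    rw [EventuallyLE, ae_restrict_iff' measurableSet_Icc]
    filter_upwards [hle, hz'.ae_hasDerivAt_integral] with t h1 h2 ht
    have htb : t ∈ Icc (0:ℝ) b := ⟨ht.1, ht.2.trans hτ.2⟩
    have hd : HasDerivAt y (z' t) t := by
      have := (h2 (by rwa [uIcc_of_le hb]) 0 (by simp)).const_add (z 0)
      exact this
    have hd2 : HasDerivAt (fun t => ‖y t‖ * ‖y t‖) (2 * ⟪y t, z' t⟫) t := by
      have := hd.norm_sq
      simpa [pow_two] using this
    rw [hd2.deriv, real_inner_comm]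
    have h3 := h1 htb
    rw [hz t htb] at h3
    have h4 : ‖y t‖ ≤ ‖y τ‖ := hmax htb
    have h5 := mul_le_mul_of_nonneg_left h4 (hφ0 t htb)
    change ⟪z' t, y t⟫ ≤ φ t * ‖y t‖ at h3
    nlinarith
  rw [hint, intervalIntegral.integral_const_mul] at hdle
  have hsplit : ∫ s in (0:ℝ)..τ, φ s ≤ ∫ s in (0:ℝ)..b, φ s := by
    rw [← intervalIntegral.integral_add_adjacent_intervals hφτ hφτb]
    have : 0 ≤ ∫ s in τ..b, φ s := intervalIntegral.integral_nonneg hτ.2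
      fun u hu => hφ0 u ⟨hτ.1.trans hu.1, hu.2⟩
    linarith
  have hy0 : y 0 = z 0 := by simp [hy]
  have h0b : (0:ℝ) ∈ Icc 0 b := ⟨le_rfl, hb⟩
  have h00 : ‖y 0‖ ≤ ‖y τ‖ := hmax h0b
  intro t ht
  have htt : ‖y t‖ ≤ ‖y τ‖ := hmax ht
  rw [hz t ht]
  change ‖y t‖ ≤ _
  rw [← hy0]
  have hI0 : 0 ≤ ∫ s in (0:ℝ)..b, φ s := intervalIntegral.integral_nonneg hb hφ0
  refine htt.trans ?_
  rcases (norm_nonneg (y τ)).eq_or_lt with h | h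
  · rw [← h]; positivity
  · refine le_of_mul_le_mul_left ?_ h
    have e1 := mul_le_mul_of_nonneg_left hsplit (by positivity : 0 ≤ 2 * ‖y τ‖)
    have e2 := mul_le_mul_of_nonneg_right h00 (norm_nonneg (y 0))
    nlinarith

/-- A nondecreasing majorant of the oscillation of a function of bounded variation. -/
lemma brezis_variation {n : ℕ} (T : ℝ) (f : ℝ → EuclideanSpace ℝ (Fin n))
    (hf : BoundedVariationOn f (Icc 0 T)) :
    ∃ V : ℝ → ℝ, ∃ W : ℝ, Monotone V ∧ (∀ t, 0 ≤ V t) ∧ (∀ t, V t ≤ W) ∧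
      ∀ s ∈ Icc (0:ℝ) T, ∀ t ∈ Icc (0:ℝ) T, s ≤ t → ‖f t - f s‖ ≤ V t - V s := by
  have hfin : ∀ t, eVariationOn f (Icc 0 T ∩ Iic t) ≠ ⊤ := fun t =>
    hf.mono inter_subset_left
  refine ⟨fun t => (eVariationOn f (Icc 0 T ∩ Iic t)).toReal, (eVariationOn f (Icc 0 T)).toReal,
    ?_, fun t => ENNReal.toReal_nonneg, ?_, ?_⟩
  · intro s t hst
    exact ENNReal.toReal_mono (hfin t)
      (eVariationOn.mono f (inter_subset_inter_right _ (Iic_subset_Iic.2 hst)))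
  · intro t
    exact ENNReal.toReal_mono hf (eVariationOn.mono f inter_subset_left)
  · intro s hs t ht hst
    have h1 : eVariationOn f (Icc 0 T ∩ Iic s) + eVariationOn f (Icc s t)
        ≤ eVariationOn f (Icc 0 T ∩ Iic t) := by
      refine (eVariationOn.add_le_union f fun x hx y hy => (hx.2.trans hy.1 : x ≤ y)).trans
        (eVariationOn.mono f ?_)
      rintro x (hx | hx)
      · exact ⟨hx.1, le_trans hx.2 hst⟩
      · exact ⟨⟨hs.1.trans hx.1, hx.2.trans ht.2⟩, hx.2⟩
    have h2 : edist (f t) (f s) ≤ eVariationOn f (Icc s t) :=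
      eVariationOn.edist_le f (right_mem_Icc.2 hst) (left_mem_Icc.2 hst)
    have h3 := ENNReal.toReal_mono (hfin t) ((add_le_add_right h2 _).trans h1)
    rw [ENNReal.toReal_add (hfin s) (edist_ne_top _ _), ← dist_edist, dist_eq_norm] at h3
    linarith

lemma brezis_lipschitz {n : ℕ} (T : ℝ) (hT : 0 < T)
    (A : EuclideanSpace ℝ (Fin n) → Set (EuclideanSpace ℝ (Fin n)))
    (hA : MaximalMonotone A)
    (f : ℝ → EuclideanSpace ℝ (Fin n))
    (hf : BoundedVariationOn f (Icc 0 T))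
    (x x' : ℝ → EuclideanSpace ℝ (Fin n))
    (hx'int : IntervalIntegrable x' volume 0 T)
    (hxAC : ∀ t ∈ Icc (0 : ℝ) T, x t = x 0 + ∫ s in (0 : ℝ)..t, x' s)
    (hincl : ∀ᵐ t ∂volume, t ∈ Icc (0 : ℝ) T →
      ∃ w ∈ A (x t), x' t = -w + f t)
    (h0 : (A (x 0)).Nonempty) : ∃ L : NNReal, LipschitzOnWith L x (Icc 0 T) := by
  obtain ⟨v, hv⟩ := h0
  obtain ⟨V, W, hVm, hV0, hVW, hVf⟩ := brezis_variation T f hf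
  have hW0 : 0 ≤ W := (hV0 0).trans (hVW 0)
  set C : ℝ := ‖f 0 - v‖ + W with hC
  have hC0 : 0 ≤ C := by positivity
  have hfv : ∀ t ∈ Icc (0:ℝ) T, ‖f t - v‖ ≤ C := by
    intro t ht
    have h1 := hVf 0 ⟨le_rfl, hT.le⟩ t ht ht.1
    have h2 : f t - v = (f 0 - v) + (f t - f 0) := by abel
    have h3 := norm_add_le (f 0 - v) (f t - f 0)
    rw [← h2] at h3
    linarith [hV0 0, hVW t]
  have hsub : ∀ {a b : ℝ}, 0 ≤ a → a ≤ b → b ≤ T → IntervalIntegrable x' volume a b := by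
    intro a b h1 h2 h3
    refine hx'int.mono_set ?_
    rw [uIcc_of_le h2, uIcc_of_le hT.le]
    exact Icc_subset_Icc h1 h3
  -- first estimate
  have est1 : ∀ h ∈ Icc (0:ℝ) T, ‖x h - x 0‖ ≤ 2 * (C * h) := by
    intro h hh
    have key := brezis_gronwall h hh.1 (fun t => x t - x 0) x' (hsub le_rfl hh.1 hh.2)
      (fun t ht => by
        have := hxAC t ⟨ht.1, ht.2.trans hh.2⟩
        rw [this]; simp) (fun _ => C) (by simp) (fun _ _ => hC0) (by
        filter_upwards [hincl] with t ht htm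
        have htT : t ∈ Icc (0:ℝ) T := ⟨htm.1, htm.2.trans hh.2⟩
        obtain ⟨w, hw, hxw⟩ := ht htT
        have hm := hA.1 (x t) (x 0) w v hw hv
        have hcs : ⟪f t - v, x t - x 0⟫ ≤ C * ‖x t - x 0‖ :=
          (real_inner_le_norm _ _).trans
            (mul_le_mul_of_nonneg_right (hfv t htT) (norm_nonneg _))
        have he : x' t = (f t - v) - (w - v) := by rw [hxw]; abel
        rw [he, inner_sub_left]
        linarith) h ⟨hh.1, le_rfl⟩
    simpa [mul_comm, mul_left_comm] using key
  -- second estimate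
  have est2 : ∀ s ∈ Icc (0:ℝ) T, ∀ t ∈ Icc (0:ℝ) T, s ≤ t →
      ‖x t - x s‖ ≤ (2 * C + 2 * W) * (t - s) := by
    intro s hs t ht hst
    set h := t - s with hh
    have hh0 : 0 ≤ h := by linarith
    have hhT : h ∈ Icc (0:ℝ) T := ⟨hh0, by linarith [hs.1, ht.2]⟩
    have hx'sh : IntervalIntegrable (fun r => x' (r + h)) volume 0 s := by
      have := (hsub (a := h) (b := s + h) hh0 (by linarith [hs.1])
        (by linarith [ht.2])).comp_add_right h
      simpa using this
    have hshift : ∀ᵐ r ∂(volume : Measure ℝ), r + h ∈ Icc (0 : ℝ) T →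
        ∃ w ∈ A (x (r + h)), x' (r + h) = -w + f (r + h) :=
      (measurePreserving_add_right volume h).quasiMeasurePreserving.ae hincl
    have hVi : ∀ a b : ℝ, IntervalIntegrable V volume a b := fun a b =>
      hVm.intervalIntegrable
    have hVsh : IntervalIntegrable (fun r => V (r + h)) volume 0 s :=
      Monotone.intervalIntegrable (fun a b hab => hVm (by linarith))
    have key := brezis_gronwall s hs.1 (fun r => x (r + h) - x r)
      (fun r => x' (r + h) - x' r) (hx'sh.sub (hsub le_rfl hs.1 hs.2))
      (fun r hr => by
        have hr2 : r + h ≤ T := by linarith [hr.2, ht.2]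
        have hrT : r ≤ T := hr.2.trans hs.2
        have e1 := hxAC (r + h) ⟨by linarith [hr.1], hr2⟩
        have e2 := hxAC r ⟨hr.1, hrT⟩
        have e3 := hxAC h hhT
        have i1 : IntervalIntegrable (fun r => x' (r + h)) volume 0 r := by
          refine hx'sh.mono_set ?_
          rw [uIcc_of_le hr.1, uIcc_of_le hs.1]
          exact Icc_subset_Icc le_rfl hr.2
        have e4 : ∫ q in (0:ℝ)..r, (x' (q + h) - x' q)
            = (∫ q in h..(r + h), x' q) - ∫ q in (0:ℝ)..r, x' q := by
          rw [intervalIntegral.integral_sub i1 (hsub le_rfl hr.1 hrT),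
            intervalIntegral.integral_comp_add_right]
          simp
        have e5 := intervalIntegral.integral_add_adjacent_intervals
          (hsub le_rfl hh0 hhT.2) (hsub hh0 (by linarith [hr.1] : h ≤ r + h) hr2)
        simp only [zero_add]
        rw [e4, e1, e2, e3, ← e5]
        abel)
      (fun r => V (r + h) - V r) (hVsh.sub (hVi _ _))
      (fun r _ => sub_nonneg.2 (hVm (by linarith))) (by
        filter_upwards [hincl, hshift] with r h1 h2 hr
        have hr1 : r ∈ Icc (0:ℝ) T := ⟨hr.1, hr.2.trans hs.2⟩
        have hr2 : r + h ∈ Icc (0:ℝ) T := ⟨by linarith [hr.1], by linarith [hr.2, ht.2]⟩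
        obtain ⟨w, hw, e1⟩ := h1 hr1
        obtain ⟨w2, hw2, e2⟩ := h2 hr2
        have hm := hA.1 (x (r + h)) (x r) w2 w hw2 hw
        have hcs : ⟪f (r + h) - f r, x (r + h) - x r⟫ ≤ (V (r + h) - V r) * ‖x (r + h) - x r‖ :=
          (real_inner_le_norm _ _).trans
            (mul_le_mul_of_nonneg_right (hVf r hr1 _ hr2 (by linarith)) (norm_nonneg _))
        have he : x' (r + h) - x' r = (f (r + h) - f r) - (w2 - w) := by rw [e1, e2]; abel
        rw [he, inner_sub_left]
        linarith) s ⟨hs.1, le_rfl⟩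
    have hint : ∫ r in (0:ℝ)..s, (V (r + h) - V r) ≤ W * h := by
      rw [intervalIntegral.integral_sub hVsh (hVi _ _), intervalIntegral.integral_comp_add_right]
      have e1 := intervalIntegral.integral_add_adjacent_intervals (hVi 0 h) (hVi h (s + h))
      have e2 := intervalIntegral.integral_add_adjacent_intervals (hVi 0 s) (hVi s (s + h))
      have e3 : ∫ r in s..(s + h), V r ≤ W * h := by
        have := intervalIntegral.integral_mono_on (by linarith : s ≤ s + h) (hVi s (s + h))
          (intervalIntegrable_const (c := W)) (fun r _ => hVW r)
        simpa [mul_comm] using this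
      have e4 : 0 ≤ ∫ r in (0:ℝ)..h, V r :=
        intervalIntegral.integral_nonneg hh0 fun r _ => hV0 r
      simp only [zero_add]
      linarith
    have hsh : s + h = t := by simp [hh]
    have := est1 h hhT
    simp only [zero_add, hsh] at key
    linarith
  refine ⟨⟨2 * C + 2 * W, by positivity⟩, LipschitzOnWith.of_dist_le_mul ?_⟩
  intro s hs t ht
  change dist (x s) (x t) ≤ (2 * C + 2 * W) * dist s t
  rcases le_total s t with hst | hst
  · rw [dist_comm, dist_comm s, dist_eq_norm, Real.dist_eq, abs_of_nonneg (by linarith)]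
    exact est2 s hs t ht hst
  · rw [dist_eq_norm, Real.dist_eq, abs_of_nonneg (by linarith)]
    exact est2 t ht s hs hst

lemma brezis_domain {n : ℕ} (T : ℝ) (hT : 0 < T)
    (A : EuclideanSpace ℝ (Fin n) → Set (EuclideanSpace ℝ (Fin n)))
    (hA : MaximalMonotone A)
    (f : ℝ → EuclideanSpace ℝ (Fin n))
    (hf : BoundedVariationOn f (Icc 0 T))
    (x x' : ℝ → EuclideanSpace ℝ (Fin n))
    (hx'int : IntervalIntegrable x' volume 0 T)
    (hxAC : ∀ t ∈ Icc (0 : ℝ) T, x t = x 0 + ∫ s in (0 : ℝ)..t, x' s)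
    (hincl : ∀ᵐ t ∂volume, t ∈ Icc (0 : ℝ) T →
      ∃ w ∈ A (x t), x' t = -w + f t)
    (L : NNReal) (hL : LipschitzOnWith L x (Icc 0 T)) :
    ∀ t ∈ Icc (0 : ℝ) T, (A (x t)).Nonempty := by
  intro t ht
  obtain ⟨V, W, hVm, hV0, hVW, hVf⟩ := brezis_variation T f hf
  set R : ℝ := ‖f 0‖ + W + L with hR
  have hgood : ∀ᵐ s ∂(volume : Measure ℝ), s ∈ Ioo (0:ℝ) T →
      ∃ w ∈ A (x s), ‖w‖ ≤ R := by
    filter_upwards [hincl, hx'int.ae_hasDerivAt_integral] with s h1 h2 hs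
    have hsI : s ∈ Icc (0:ℝ) T := Ioo_subset_Icc_self hs
    obtain ⟨w, hw, e⟩ := h1 hsI
    have hnhds : Icc (0:ℝ) T ∈ 𝓝 s := Icc_mem_nhds hs.1 hs.2
    have hd : HasDerivAt x (x' s) s := by
      have := (h2 (by rwa [uIcc_of_le hT.le]) 0 (by simp)).const_add (x 0)
      refine this.congr_of_eventuallyEq ?_
      filter_upwards [hnhds] with r hr using hxAC r hr
    have hb : ‖x' s‖ ≤ L := hd.le_of_lipschitzOn hnhds hL
    refine ⟨w, hw, ?_⟩
    have e1 := hVf 0 ⟨le_rfl, hT.le⟩ s hsI hsI.1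
    have e2 : w = f 0 + (f s - f 0) - x' s := by rw [e]; abel
    have e3 := norm_sub_le (f 0 + (f s - f 0)) (x' s)
    have e4 := norm_add_le (f 0) (f s - f 0)
    rw [← e2] at e3
    linarith [hV0 0, hVW s]
  -- good points are dense
  have hex : ∀ k : ℕ, ∃ s ∈ Ioo (0:ℝ) T, |s - t| < 1 / ((k:ℝ) + 1) ∧ ∃ w ∈ A (x s), ‖w‖ ≤ R := by
    intro k
    have hd : Dense {s : ℝ | s ∈ Ioo (0:ℝ) T → ∃ w ∈ A (x s), ‖w‖ ≤ R} :=
      Measure.dense_of_ae hgood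
    have hk : (0:ℝ) < 1 / ((k:ℝ) + 1) := by positivity
    have hne : (Ioo (0:ℝ) T ∩ Metric.ball t (1 / ((k:ℝ) + 1))).Nonempty := by
      have hc : t ∈ closure (Ioo (0:ℝ) T) := by rwa [closure_Ioo hT.ne]
      obtain ⟨r, hr, hrt⟩ := Metric.mem_closure_iff.1 hc _ hk
      exact ⟨r, hr, by rwa [Metric.mem_ball, dist_comm]⟩
    obtain ⟨s, hs, hs2⟩ := hd.inter_open_nonempty _ (isOpen_Ioo.inter Metric.isOpen_ball) hne
    exact ⟨s, hs.1, by simpa [Real.dist_eq] using hs.2, hs2 hs.1⟩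
  choose s hs hst w hw hwR using hex
  have hslim : Tendsto s atTop (𝓝 t) := by
    rw [tendsto_iff_dist_tendsto_zero]
    refine squeeze_zero (fun _ => dist_nonneg) (fun k => ?_)
      (tendsto_one_div_add_atTop_nhds_zero_nat (𝕜 := ℝ))
    rw [Real.dist_eq]
    exact (hst k).le
  have hxlim : Tendsto (fun k => x (s k)) atTop (𝓝 (x t)) := by
    have hc := hL.continuousOn t ht
    exact hc.tendsto.comp (tendsto_nhdsWithin_iff.2
      ⟨hslim, Eventually.of_forall fun k => Ioo_subset_Icc_self (hs k)⟩)
  obtain ⟨u, -, ψ, hψ, hu⟩ := (isCompact_closedBall (0 : EuclideanSpace ℝ (Fin n)) R).tendsto_subseq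
    (x := w) (fun k => by simpa using hwR k)
  refine ⟨u, hA.2 _ _ fun y v hv => ?_⟩
  have hlim : Tendsto (fun k => ⟪w (ψ k) - v, x (s (ψ k)) - y⟫) atTop (𝓝 ⟪u - v, x t - y⟫) :=
    (hu.sub_const v).inner ((hxlim.comp hψ.tendsto_atTop).sub_const y)
  exact ge_of_tendsto' hlim fun k => hA.1 _ _ _ _ (hw _) hv

/-- Brezis lemma, equivalence part: for a solution of
`ẋ(t) ∈ -A(x(t)) + f(t)` with `A` maximal monotone and `f` of bounded
variation, `x(0) ∈ D(A)` iff `x` is Lipschitz on `[0,T]`; in this case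
`x(t) ∈ D(A)` for all `t ∈ [0,T]`. -/
theorem stmt4 {n : ℕ} (T : ℝ) (hT : 0 < T)
    (A : EuclideanSpace ℝ (Fin n) → Set (EuclideanSpace ℝ (Fin n)))
    (hA : MaximalMonotone A)
    (f : ℝ → EuclideanSpace ℝ (Fin n))
    (hf : BoundedVariationOn f (Icc 0 T))
    (x x' : ℝ → EuclideanSpace ℝ (Fin n))
    (hx'int : IntervalIntegrable x' volume 0 T)
    (hxAC : ∀ t ∈ Icc (0 : ℝ) T, x t = x 0 + ∫ s in (0 : ℝ)..t, x' s)
    (hincl : ∀ᵐ t ∂volume, t ∈ Icc (0 : ℝ) T →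
      ∃ w ∈ A (x t), x' t = -w + f t) :
    ((A (x 0)).Nonempty ↔ ∃ L : NNReal, LipschitzOnWith L x (Icc 0 T)) ∧
    ((A (x 0)).Nonempty → ∀ t ∈ Icc (0 : ℝ) T, (A (x t)).Nonempty) := by
  have hd := brezis_domain T hT A hA f hf x x' hx'int hxAC hincl
  have hl := brezis_lipschitz T hT A hA f hf x x' hx'int hxAC hincl
  refine ⟨⟨hl, fun ⟨L, hL⟩ => hd L hL 0 ⟨le_rfl, hT.le⟩⟩, fun h => ?_⟩
  obtain ⟨L, hL⟩ := hl h
  exact hd L hL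
end
end

section
/- (Brezis lemma, right-derivative formula.) Let A : ℝ^n → 𝒫(ℝ^n) be a maximal monotone set-valued operator, let f : [0,T] → ℝ^n have bounded variation, and let x : [0,T] → ℝ^n be absolutely continuous with ẋ(t) ∈ −A(x(t)) + f(t) for a.e. t ∈ [0,T] and x(0) ∈ D(A). Then for every t ∈ [0,T): the limit f(t⁺) := lim_{h↓0} (1/h)∫_t^{t+h} f(r) dr exists; there is a unique point p(t) ∈ A(x(t)) satisfying ‖p(t) − f(t⁺)‖ ≤ ‖q − f(t⁺)‖ for all q ∈ A(x(t)); x is right differentiable at t; and the right derivative satisfies ẋ⁺(t) = f(t⁺) − p(t). -/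
open MeasureTheory Set Filter
open scoped RealInnerProductSpace Topology

noncomputable section

section Aux

/-- The first function is an indefinite integral of the second one on the interval. -/
def BrACOn {n : ℕ} (z z' : ℝ → EuclideanSpace ℝ (Fin n)) (a b : ℝ) : Prop :=
  IntervalIntegrable z' volume a b ∧
    ∀ s ∈ Icc a b, ∀ t ∈ Icc a b, z t - z s = ∫ r in s..t, z' r

variable {n : ℕ}

local notation "E" => EuclideanSpace ℝ (Fin n)

lemma br_intInt_sub {F : Type*} [NormedAddCommGroup F] {g : ℝ → F} {a b s t : ℝ}
    (hg : IntervalIntegrable g volume a b)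
    (hs : s ∈ Icc a b) (ht : t ∈ Icc a b) : IntervalIntegrable g volume s t := by
  apply hg.mono_set
  have hab : a ≤ b := hs.1.trans hs.2
  rw [uIcc_of_le hab]
  exact uIcc_subset_Icc hs ht

lemma BrACOn.mono {z z' : ℝ → E} {a b c d : ℝ} (h : BrACOn z z' a b)
    (hc : c ∈ Icc a b) (hd : d ∈ Icc a b) : BrACOn z z' c d := by
  have hsub : Icc c d ⊆ Icc a b := Icc_subset_Icc hc.1 hd.2
  exact ⟨br_intInt_sub h.1 hc hd, fun s hs t ht => h.2 s (hsub hs) t (hsub ht)⟩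

lemma BrACOn.sub_const {z z' : ℝ → E} {a b : ℝ} (h : BrACOn z z' a b) (y : E) :
    BrACOn (fun t => z t - y) z' a b :=
  ⟨h.1, fun s hs t ht => by
    change z t - y - (z s - y) = _
    rw [← h.2 s hs t ht]; abel⟩

lemma BrACOn.sub {z z' w w' : ℝ → E} {a b : ℝ} (h : BrACOn z z' a b) (h2 : BrACOn w w' a b) :
    BrACOn (fun t => z t - w t) (fun t => z' t - w' t) a b :=
  ⟨h.1.sub h2.1, fun s hs t ht => by
    rw [intervalIntegral.integral_sub (br_intInt_sub h.1 hs ht) (br_intInt_sub h2.1 hs ht),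
      ← h.2 s hs t ht, ← h2.2 s hs t ht]
    change z t - w t - (z s - w s) = _
    abel⟩

lemma BrACOn.shift {z z' : ℝ → E} {a b c : ℝ} (h : BrACOn z z' (a + c) (b + c)) :
    BrACOn (fun t => z (t + c)) (fun t => z' (t + c)) a b := by
  refine ⟨?_, fun s hs t ht => ?_⟩
  · have := h.1.comp_add_right c
    simpa using this
  · rw [intervalIntegral.integral_comp_add_right]
    apply h.2
    · exact ⟨by linarith [hs.1], by linarith [hs.2]⟩
    · exact ⟨by linarith [ht.1], by linarith [ht.2]⟩

lemma br_ac_of_dist_le {φ G : ℝ → ℝ} {a b C : ℝ}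
    (hG : AbsolutelyContinuousOnInterval G a b)
    (h : ∀ s ∈ uIcc a b, ∀ t ∈ uIcc a b, dist (φ s) (φ t) ≤ C * dist (G s) (G t)) :
    AbsolutelyContinuousOnInterval φ a b := by
  have hG' := Tendsto.const_mul C hG
  rw [mul_zero] at hG'
  refine squeeze_zero' ?_ ?_ hG'
  · filter_upwards with I
    exact Finset.sum_nonneg (fun _ _ ↦ dist_nonneg)
  · have : ∀ᶠ (I : ℕ × (ℕ → ℝ × ℝ)) in AbsolutelyContinuousOnInterval.totalLengthFilter ⊓
        𝓟 (AbsolutelyContinuousOnInterval.disjWithin a b),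
        I ∈ AbsolutelyContinuousOnInterval.disjWithin a b :=
      eventually_inf_principal.mpr (by simp)
    filter_upwards [this] with I hE
    rw [Finset.mul_sum]
    exact Finset.sum_le_sum fun i hi => h _ (hE.1 i hi).1 _ (hE.1 i hi).2

lemma BrACOn.dist_le {z z' : ℝ → E} {a b : ℝ} (hab : a ≤ b) (h : BrACOn z z' a b) :
    ∀ s ∈ uIcc a b, ∀ t ∈ uIcc a b,
      dist (z s) (z t) ≤ dist (∫ r in a..s, ‖z' r‖) (∫ r in a..t, ‖z' r‖) := by
  intro s hs t ht
  rw [uIcc_of_le hab] at hs ht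
  have ha : a ∈ Icc a b := ⟨le_rfl, hab⟩
  rw [dist_comm (z s), dist_comm (∫ r in a..s, ‖z' r‖), dist_eq_norm, h.2 s hs t ht, Real.dist_eq,
    intervalIntegral.integral_interval_sub_left (br_intInt_sub h.1.norm ha ht)
      (br_intInt_sub h.1.norm ha hs)]
  exact intervalIntegral.norm_integral_le_abs_integral_norm

lemma BrACOn.ac_norm {z z' : ℝ → E} {a b : ℝ} (hab : a ≤ b) (h : BrACOn z z' a b) :
    AbsolutelyContinuousOnInterval (fun t => ‖z t‖) a b := by
  refine br_ac_of_dist_le (C := 1)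
    (h.1.norm.absolutelyContinuousOnInterval_intervalIntegral (c := a) (by simp)) ?_
  intro s hs t ht
  rw [one_mul]
  refine le_trans ?_ (h.dist_le hab s hs t ht)
  rw [Real.dist_eq, dist_eq_norm]
  exact abs_norm_sub_norm_le _ _

lemma BrACOn.ac_norm_sq {z z' : ℝ → E} {a b : ℝ} (hab : a ≤ b) (h : BrACOn z z' a b) :
    AbsolutelyContinuousOnInterval (fun t => ‖z t‖ ^ 2) a b := by
  simp only [pow_two]
  exact (h.ac_norm hab).fun_mul (h.ac_norm hab)

lemma BrACOn.ae_hasDerivAt {z z' : ℝ → E} {a b : ℝ} (hab : a ≤ b) (h : BrACOn z z' a b) :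
    ∀ᵐ t ∂volume, t ∈ Ioo a b → HasDerivAt z (z' t) t := by
  filter_upwards [h.1.ae_hasDerivAt_integral] with t ht hto
  have hI : t ∈ Icc a b := Ioo_subset_Icc_self hto
  have ha : a ∈ Icc a b := ⟨le_rfl, hab⟩
  have h1 := (ht (by rw [uIcc_of_le hab]; exact hI) a (by simp)).const_add (z a)
  refine h1.congr_of_eventuallyEq ?_
  filter_upwards [Icc_mem_nhds hto.1 hto.2] with s hs
  rw [← h.2 a ha s hs]; abel

lemma br_continuousOn {z z' : ℝ → E} {a b : ℝ} (hab : a ≤ b) (h : BrACOn z z' a b) :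
    ContinuousOn z (Icc a b) := by
  have ha : a ∈ Icc a b := ⟨le_rfl, hab⟩
  have h1 : ContinuousOn (fun t => z a + ∫ r in a..t, z' r) (Icc a b) := by
    have := intervalIntegral.continuousOn_primitive_interval' h.1 (a := a) (by simp)
    rw [uIcc_of_le hab] at this
    exact continuousOn_const.add this
  refine h1.congr fun t ht => ?_
  change z t = z a + ∫ r in a..t, z' r
  rw [← h.2 a ha t ht]; abel

lemma br_sub_le {φ g : ℝ → ℝ} {a b : ℝ} (hab : a ≤ b)
    (hφ : AbsolutelyContinuousOnInterval φ a b) (hg : IntervalIntegrable g volume a b)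
    (h : ∀ᵐ t ∂volume, t ∈ Ioo a b → DifferentiableAt ℝ φ t → deriv φ t ≤ g t) :
    φ b - φ a ≤ ∫ t in a..b, g t := by
  rw [← hφ.integral_deriv_eq_sub]
  refine intervalIntegral.integral_mono_ae_restrict hab hφ.intervalIntegrable_deriv hg ?_
  rw [EventuallyLE, ← restrict_Ioo_eq_restrict_Icc, ae_restrict_iff' measurableSet_Ioo]
  filter_upwards [h, hφ.ae_differentiableAt] with t ht hd hto
  exact ht hto (hd (by rw [uIcc_of_le hab]; exact Ioo_subset_Icc_self hto))

lemma BrACOn.norm_le {z z' : ℝ → E} {g : ℝ → ℝ} {a b : ℝ} (hab : a ≤ b) (h : BrACOn z z' a b)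
    (hg : IntervalIntegrable g volume a b) (hg0 : ∀ t ∈ Icc a b, 0 ≤ g t)
    (hz : ∀ᵐ t ∂volume, t ∈ Icc a b → ⟪z' t, z t⟫ ≤ g t * ‖z t‖) :
    ‖z b‖ - ‖z a‖ ≤ ∫ t in a..b, g t := by
  refine br_sub_le hab (h.ac_norm hab) hg ?_
  filter_upwards [h.ae_hasDerivAt hab, hz] with t hd hz hto hdn
  have hd := hd hto
  have htI := Ioo_subset_Icc_self hto
  have hz := hz htI
  by_cases h0 : z t = 0
  · have hmin : IsLocalMin (fun t => ‖z t‖) t := by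
      filter_upwards with s
      simp [h0]
    rw [hmin.deriv_eq_zero]
    exact hg0 t htI
  · have hn : 0 < ‖z t‖ := norm_pos_iff.2 h0
    have h1 := hd.norm_sq
    have h2 := hdn.hasDerivAt.pow 2
    have h3 := h2.unique h1
    simp only [Nat.cast_ofNat, Nat.add_one_sub_one, pow_one] at h3
    rw [real_inner_comm] at hz
    refine le_of_mul_le_mul_right ?_ hn
    linarith

lemma BrACOn.norm_sq_le {z z' : ℝ → E} {g : ℝ → ℝ} {a b : ℝ} (hab : a ≤ b)
    (h : BrACOn z z' a b)
    (hg : IntervalIntegrable g volume a b)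
    (hz : ∀ᵐ t ∂volume, t ∈ Icc a b → ⟪z' t, z t⟫ ≤ g t) :
    ‖z b‖ ^ 2 - ‖z a‖ ^ 2 ≤ 2 * ∫ t in a..b, g t := by
  rw [← intervalIntegral.integral_const_mul]
  refine br_sub_le hab (h.ac_norm_sq hab) (hg.const_mul 2) ?_
  filter_upwards [h.ae_hasDerivAt hab, hz] with t hd hz hto hdn
  have hz := hz (Ioo_subset_Icc_self hto)
  rw [(hd hto).norm_sq.deriv, real_inner_comm]
  linarith

lemma br_average {F : Type*} [NormedAddCommGroup F] [NormedSpace ℝ F] [CompleteSpace F]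
    {g : ℝ → F} {t b : ℝ} {c : F}
    (htb : t < b) (hg : IntervalIntegrable g volume t b) (hc : Tendsto g (𝓝[>] t) (𝓝 c)) :
    Tendsto (fun h : ℝ => h⁻¹ • ∫ s in t..(t + h), g s) (𝓝[>] (0 : ℝ)) (𝓝 c) := by
  have hm : StronglyMeasurableAtFilter g (𝓝[>] t) := by
    refine ⟨Ioc t b, Ioc_mem_nhdsGT htb, ?_⟩
    exact hg.1.aestronglyMeasurable
  have h1 : HasDerivWithinAt (fun u => ∫ x in t..u, g x) c (Ici t) t :=
    intervalIntegral.integral_hasDerivWithinAt_of_tendsto_ae_right (by simp) hm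
      (hc.mono_left inf_le_left)
  have h2 := h1.mono Ioi_subset_Ici_self
  rw [hasDerivWithinAt_iff_tendsto_slope' (by simp)] at h2
  have h3 : Tendsto (fun h : ℝ => t + h) (𝓝[>] 0) (𝓝[>] t) := by
    refine tendsto_nhdsWithin_iff.2 ⟨?_, ?_⟩
    · have : Tendsto (fun h : ℝ => t + h) (𝓝 0) (𝓝 (t + 0)) := tendsto_id.const_add t
      rw [add_zero] at this
      exact this.mono_left nhdsWithin_le_nhds
    · filter_upwards [self_mem_nhdsWithin] with h hh
      simpa using hh
  refine (h2.comp h3).congr fun h => ?_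
  simp [slope]

lemma br_f_integrable {f : ℝ → E} {T : ℝ} (hT : 0 ≤ T) (hf : BoundedVariationOn f (Icc 0 T)) :
    IntervalIntegrable f volume 0 T := by
  have hi : ∀ i, IntervalIntegrable (fun t => f t i) volume 0 T := by
    intro i
    have hL : LipschitzWith 1 (fun u : E => u i) :=
      LipschitzWith.of_dist_le_mul fun u v => by
        rw [NNReal.coe_one, one_mul, dist_eq_norm, dist_eq_norm]
        exact PiLp.norm_apply_le (u - v) i
    have := hL.comp_locallyBoundedVariationOn hf.locallyBoundedVariationOn
    obtain ⟨p, q, hp, hq, he⟩ := this.exists_monotoneOn_sub_monotoneOn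
    have he' : (fun t => f t i) = p - q := he
    rw [he']
    rw [← uIcc_of_le hT] at hp hq
    exact hp.intervalIntegrable.sub hq.intervalIntegrable
  rw [intervalIntegrable_iff]
  refine Integrable.of_eval_piLp fun i => ?_
  exact (intervalIntegrable_iff.1 (hi i))

lemma br_convex {A : E → Set E} (hA : MaximalMonotone A) (x : E) : Convex ℝ (A x) := by
  intro u hu w hw a b ha hb hab
  refine hA.2 x _ fun y v hv => ?_
  have h1 := hA.1 x y u v hu hv
  have h2 := hA.1 x y w v hw hv
  have : a • u + b • w - v = a • (u - v) + b • (w - v) := by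
    have : v = (a + b) • v := by rw [hab, one_smul]
    nth_rewrite 1 [this]
    module
  rw [this, inner_add_left, real_inner_smul_left, real_inner_smul_left]
  positivity

lemma br_closed {A : E → Set E} (hA : MaximalMonotone A) (x : E) : IsClosed (A x) := by
  have : A x = ⋂ (y : E) (v : E) (_ : v ∈ A y), {u | 0 ≤ ⟪u - v, x - y⟫} := by
    ext u
    simp only [mem_iInter]
    exact ⟨fun hu y v hv => hA.1 x y u v hu hv, fun h => hA.2 x u h⟩
  rw [this]
  refine isClosed_iInter fun y => isClosed_iInter fun v => isClosed_iInter fun _ => ?_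
  exact isClosed_le continuous_const (by fun_prop)

lemma br_proj {K : Set E} (hK : Convex ℝ K) (hc : IsClosed K) (hne : K.Nonempty) (c : E) :
    ∃ p ∈ K, (∀ q ∈ K, ‖p - c‖ ≤ ‖q - c‖) ∧ ∀ q ∈ K, ‖q - c‖ ≤ ‖p - c‖ → q = p := by
  obtain ⟨p, hp, he⟩ := exists_norm_eq_iInf_of_complete_convex hne hc.isComplete hK c
  have hin := (norm_eq_iInf_iff_real_inner_le_zero hK hp).1 he
  have key : ∀ q ∈ K, ‖p - c‖ ^ 2 + ‖q - p‖ ^ 2 ≤ ‖q - c‖ ^ 2 := by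
    intro q hq
    have h1 := hin q hq
    have h2 : q - c = (q - p) - (c - p) := by abel
    rw [h2, norm_sub_sq_real (q - p) (c - p), norm_sub_rev p c, real_inner_comm]
    linarith
  refine ⟨p, hp, fun q hq => ?_, fun q hq hle => ?_⟩
  · have := key q hq
    refine le_of_sq_le_sq ?_ (norm_nonneg _)
    nlinarith [sq_nonneg ‖q - p‖]
  · have h1 := key q hq
    have h2 : ‖q - c‖ ^ 2 ≤ ‖p - c‖ ^ 2 := by gcongr
    have h3 : ‖q - p‖ ^ 2 ≤ 0 := by linarith
    have h4 : ‖q - p‖ = 0 := by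
      have := sq_nonneg ‖q - p‖
      exact pow_eq_zero_iff (two_ne_zero) |>.1 (le_antisymm h3 this)
    exact sub_eq_zero.1 (norm_eq_zero.1 h4)

/-- a.e. inequality against a fixed element of the graph. -/
lemma br_ae_graph {T : ℝ} {A : E → Set E} (hA : MaximalMonotone A) {f x x' : ℝ → E}
    (hincl : ∀ᵐ t ∂volume, t ∈ Icc (0 : ℝ) T → ∃ w ∈ A (x t), x' t = -w + f t)
    {y v : E} (hv : v ∈ A y) :
    ∀ᵐ t ∂volume, t ∈ Icc (0 : ℝ) T → ⟪x' t, x t - y⟫ ≤ ⟪f t - v, x t - y⟫ := by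
  filter_upwards [hincl] with t ht htI
  obtain ⟨w, hw, he⟩ := ht htI
  have := hA.1 _ _ _ _ hw hv
  have h2 : f t - v = x' t + (w - v) := by rw [he]; abel
  rw [h2, inner_add_left]
  linarith

lemma br_step1 {T : ℝ} {A : E → Set E} (hA : MaximalMonotone A) {f x x' : ℝ → E}
    (hfi : IntervalIntegrable f volume 0 T) (hac : BrACOn x x' 0 T)
    (hincl : ∀ᵐ t ∂volume, t ∈ Icc (0 : ℝ) T → ∃ w ∈ A (x t), x' t = -w + f t)
    {s t : ℝ} (hs : s ∈ Icc 0 T) (ht : t ∈ Icc 0 T) (hst : s ≤ t) {v : E} (hv : v ∈ A (x s)) :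
    ‖x t - x s‖ ≤ ∫ r in s..t, ‖f r - v‖ := by
  have h1 := ((hac.mono hs ht).sub_const (x s)).norm_le hst (g := fun r => ‖f r - v‖)
    ((br_intInt_sub hfi hs ht).sub intervalIntegrable_const).norm (fun _ _ => norm_nonneg _) ?_
  · simpa using h1
  · filter_upwards [br_ae_graph hA hincl hv] with r hr hrI
    exact (hr ⟨hs.1.trans hrI.1, hrI.2.trans ht.2⟩).trans (real_inner_le_norm _ _)

lemma br_step2 {T : ℝ} {A : E → Set E} (hA : MaximalMonotone A) {f x x' : ℝ → E}
    (hf : BoundedVariationOn f (Icc 0 T)) (hac : BrACOn x x' 0 T)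
    (hincl : ∀ᵐ t ∂volume, t ∈ Icc (0 : ℝ) T → ∃ w ∈ A (x t), x' t = -w + f t)
    {t h : ℝ} (ht : 0 ≤ t) (hh : 0 ≤ h) (hth : t + h ≤ T) :
    ‖x (t + h) - x t‖ ≤ ‖x h - x 0‖ + h * (eVariationOn f (Icc 0 T)).toReal := by
  set V := variationOnFromTo f (Icc 0 T) 0 with hV
  set M := (eVariationOn f (Icc 0 T)).toReal with hM
  have hT : 0 ≤ T := by linarith
  have h0 : (0 : ℝ) ∈ Icc 0 T := ⟨le_rfl, hT⟩
  have hVm : MonotoneOn V (Icc 0 T) := variationOnFromTo.monotoneOn hf.locallyBoundedVariationOn h0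
  have hVi : IntervalIntegrable V volume 0 T := by
    rw [← uIcc_of_le hT] at hVm
    exact hVm.intervalIntegrable
  have htI : t ∈ Icc 0 T := ⟨ht, by linarith⟩
  have hhI : h ∈ Icc 0 T := ⟨hh, by linarith⟩
  have hthI : t + h ∈ Icc 0 T := ⟨by linarith, hth⟩
  have hVf : ∀ r ∈ Icc 0 t, ‖f (r + h) - f r‖ ≤ V (r + h) - V r := by
    intro r hr
    have hr1 : r ∈ Icc 0 T := ⟨hr.1, by linarith [hr.2]⟩
    have hr2 : r + h ∈ Icc 0 T := ⟨by linarith [hr.1], by linarith [hr.2]⟩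
    rw [hV, variationOnFromTo.sub_right hf.locallyBoundedVariationOn h0 hr2 hr1,
      variationOnFromTo.eq_of_le _ _ (by linarith), ← dist_eq_norm, dist_edist]
    apply ENNReal.toReal_mono (hf.locallyBoundedVariationOn _ _ hr1 hr2)
    apply eVariationOn.edist_le f
    · exact ⟨hr2, by linarith, le_rfl⟩
    · exact ⟨hr1, le_rfl, by linarith⟩
  have hi1 : IntervalIntegrable (fun r => V (r + h)) volume 0 t := by
    have := (br_intInt_sub hVi hhI hthI).comp_add_right h
    simpa using this
  have hi2 : IntervalIntegrable V volume 0 t := br_intInt_sub hVi h0 htI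
  have hshift : BrACOn (fun s => x (s + h)) (fun s => x' (s + h)) 0 t := by
    apply BrACOn.shift
    exact hac.mono (by simpa using hhI) hthI
  have h1 := (hshift.sub (hac.mono h0 htI)).norm_le ht (g := fun r => V (r + h) - V r)
    (hi1.sub hi2) (fun r hr => (norm_nonneg _).trans (hVf r hr)) ?_
  · simp only [zero_add] at h1
    rw [intervalIntegral.integral_sub hi1 hi2, intervalIntegral.integral_comp_add_right,
      zero_add] at h1
    have e1 := intervalIntegral.integral_add_adjacent_intervals (br_intInt_sub hVi h0 hhI)
      (br_intInt_sub hVi hhI hthI)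
    have e2 := intervalIntegral.integral_add_adjacent_intervals (br_intInt_sub hVi h0 htI)
      (br_intInt_sub hVi htI hthI)
    have e3 : 0 ≤ ∫ r in (0 : ℝ)..h, V r :=
      intervalIntegral.integral_nonneg hh fun r hr => variationOnFromTo.nonneg_of_le _ _ hr.1
    have e4 : ∫ r in t..t + h, V r ≤ ∫ r in t..t + h, M := by
      refine intervalIntegral.integral_mono_on (by linarith) (br_intInt_sub hVi htI hthI)
        intervalIntegrable_const fun r hr => ?_
      exact (le_abs_self _).trans (variationOnFromTo.abs_le_eVariationOn hf)
    rw [intervalIntegral.integral_const, smul_eq_mul, add_sub_cancel_left] at e4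
    linarith
  · have hshiftae : ∀ᵐ r ∂volume, r + h ∈ Icc (0 : ℝ) T →
        ∃ w ∈ A (x (r + h)), x' (r + h) = -w + f (r + h) :=
      (measurePreserving_add_right volume h).quasiMeasurePreserving.ae hincl
    filter_upwards [hincl, hshiftae] with r hr1 hr2 hrI
    obtain ⟨w1, hw1, he1⟩ := hr1 ⟨hrI.1, by linarith [hrI.2]⟩
    obtain ⟨w2, hw2, he2⟩ := hr2 ⟨by linarith [hrI.1], by linarith [hrI.2]⟩
    have hm := hA.1 _ _ _ _ hw2 hw1
    have hd : x' (r + h) - x' r = (f (r + h) - f r) - (w2 - w1) := by rw [he1, he2]; abel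
    rw [hd, inner_sub_left]
    have hn := real_inner_le_norm (f (r + h) - f r) (x (r + h) - x r)
    have hb := mul_le_mul_of_nonneg_right (hVf r hrI) (norm_nonneg (x (r + h) - x r))
    linarith

/-- Any limit `d` of right difference quotients satisfies `c - d ∈ A (x t)`. -/
lemma br_limit_mem {T : ℝ} {A : E → Set E} (hA : MaximalMonotone A) {f x x' : ℝ → E}
    (hfi : IntervalIntegrable f volume 0 T) (hac : BrACOn x x' 0 T)
    (hincl : ∀ᵐ t ∂volume, t ∈ Icc (0 : ℝ) T → ∃ w ∈ A (x t), x' t = -w + f t)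
    {t : ℝ} (ht : t ∈ Ico 0 T) {c d : E} (hc : Tendsto f (𝓝[>] t) (𝓝 c))
    {U : Filter ℝ} [U.NeBot] (hU : U ≤ 𝓝[>] (0 : ℝ))
    (hd : Tendsto (fun h : ℝ => h⁻¹ • (x (t + h) - x t)) U (𝓝 d)) :
    c - d ∈ A (x t) := by
  have hT : 0 ≤ T := ht.1.trans ht.2.le
  have htI : t ∈ Icc 0 T := ⟨ht.1, ht.2.le⟩
  have hTI : T ∈ Icc 0 T := ⟨hT, le_rfl⟩
  have hact := hac.mono htI hTI
  have hxc : ContinuousOn x (Icc t T) := br_continuousOn ht.2.le hact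
  refine hA.2 _ _ fun y v hv => ?_
  set g : ℝ → ℝ := fun s => ⟪f s - v, x s - y⟫ with hg
  have hgi : IntervalIntegrable g volume t T := by
    have h1 : IntervalIntegrable (fun s => f s - v) volume t T :=
      (br_intInt_sub hfi htI hTI).sub intervalIntegrable_const
    have h2 : ContinuousOn (fun s => x s - y) (Icc t T) := hxc.sub continuousOn_const
    rw [intervalIntegrable_iff_integrableOn_Icc_of_le ht.2.le] at h1 ⊢
    obtain ⟨C, hC⟩ := isCompact_Icc.exists_bound_of_continuousOn h2
    refine Integrable.mono' (h1.norm.mul_const C)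
      (h1.aestronglyMeasurable.inner (h2.aestronglyMeasurable measurableSet_Icc)) ?_
    filter_upwards [ae_restrict_mem measurableSet_Icc] with s hs
    exact (norm_inner_le_norm _ _).trans
      (mul_le_mul_of_nonneg_left (hC s hs) (norm_nonneg _))
  have hxt : Tendsto x (𝓝[>] t) (𝓝 (x t)) := by
    have := hxc t ⟨le_rfl, ht.2.le⟩
    have h2 : ContinuousWithinAt x (Ioc t T) t := this.mono Ioc_subset_Icc_self
    rw [ContinuousWithinAt, nhdsWithin_Ioc_eq_nhdsGT ht.2] at h2
    exact h2
  have hgt : Tendsto g (𝓝[>] t) (𝓝 ⟪c - v, x t - y⟫) :=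
    (hc.sub_const v).inner (hxt.sub_const y)
  have hav := (br_average ht.2 hgi hgt).mono_left hU
  have hU0 : Tendsto (fun h : ℝ => h) U (𝓝 0) := hU.trans nhdsWithin_le_nhds
  have hlhs : Tendsto (fun h : ℝ => ⟪h⁻¹ • (x (t + h) - x t), x t - y⟫ +
      h / 2 * ‖h⁻¹ • (x (t + h) - x t)‖ ^ 2) U (𝓝 (⟪d, x t - y⟫ + 0 / 2 * ‖d‖ ^ 2)) :=
    (hd.inner tendsto_const_nhds).add ((hU0.div_const 2).mul (hd.norm.pow 2))
  have hle := le_of_tendsto_of_tendsto hlhs hav ?_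
  · have e : c - d - v = (c - v) - d := by abel
    rw [e, inner_sub_left]
    simp only [zero_div, zero_mul, add_zero] at hle
    linarith
  · have hmem : ∀ᶠ h in 𝓝[>] (0 : ℝ), h ∈ Ioc 0 (T - t) :=
      Ioc_mem_nhdsGT (by linarith [ht.2])
    filter_upwards [hU hmem] with h hh
    have hh0 : 0 < h := hh.1
    have hthI : t + h ∈ Icc t T := ⟨by linarith, by linarith [hh.2]⟩
    have hthI' : t + h ∈ Icc 0 T := ⟨ht.1.trans hthI.1, hthI.2⟩
    have h1 := ((hac.mono htI hthI').sub_const y).norm_sq_le hthI.1 (g := g)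
      (br_intInt_sub hgi ⟨le_rfl, ht.2.le⟩ hthI) ?_
    · have e1 : x (t + h) - y = (x (t + h) - x t) + (x t - y) := by abel
      rw [e1, norm_add_sq_real] at h1
      rw [real_inner_smul_left, norm_smul, smul_eq_mul, mul_pow, Real.norm_eq_abs, sq_abs]
      have e2 : h / 2 * ((h⁻¹) ^ 2 * ‖x (t + h) - x t‖ ^ 2) =
          h⁻¹ * (‖x (t + h) - x t‖ ^ 2 / 2) := by field_simp
      rw [e2, ← mul_add]
      refine mul_le_mul_of_nonneg_left ?_ (inv_nonneg.2 hh0.le)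
      linarith
    · filter_upwards [br_ae_graph hA hincl hv] with r hr hrI
      exact hr ⟨ht.1.trans hrI.1, hrI.2.trans hthI.2⟩

/-- Bounded difference quotients converge along ultrafilters. -/
lemma br_ultra {q : ℝ → E} {C : ℝ} (hq : ∀ᶠ h in 𝓝[>] (0 : ℝ), ‖q h‖ ≤ C)
    (U : Ultrafilter ℝ) (hU : (U : Filter ℝ) ≤ 𝓝[>] (0 : ℝ)) :
    ∃ d, Tendsto q U (𝓝 d) := by
  have hK : IsCompact (Metric.closedBall (0 : E) C) := isCompact_closedBall _ _
  obtain ⟨d, -, hd⟩ := hK.ultrafilter_le_nhds (U.map q) (by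
    rw [le_principal_iff]
    change q ⁻¹' _ ∈ (U : Filter ℝ)
    filter_upwards [hU hq] with h hh
    simpa using hh)
  exact ⟨d, hd⟩

end Aux

/-- Brezis lemma, right-derivative formula: for a solution of
`ẋ(t) ∈ -A(x(t)) + f(t)` with `A` maximal monotone, `f` of bounded variation,
and `x(0) ∈ D(A)`, at every `t ∈ [0,T)` the right average limit `f(t⁺)` exists,
there is a unique projection `p(t)` of `f(t⁺)` onto `A(x(t))`, `x` is right
differentiable at `t`, and `ẋ⁺(t) = f(t⁺) - p(t)`. -/
theorem stmt5 {n : ℕ} (T : ℝ) (hT : 0 < T)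
    (A : EuclideanSpace ℝ (Fin n) → Set (EuclideanSpace ℝ (Fin n)))
    (hA : MaximalMonotone A)
    (f : ℝ → EuclideanSpace ℝ (Fin n))
    (hf : BoundedVariationOn f (Icc 0 T))
    (x x' : ℝ → EuclideanSpace ℝ (Fin n))
    (hx'int : IntervalIntegrable x' volume 0 T)
    (hxAC : ∀ t ∈ Icc (0 : ℝ) T, x t = x 0 + ∫ s in (0 : ℝ)..t, x' s)
    (hincl : ∀ᵐ t ∂volume, t ∈ Icc (0 : ℝ) T →
      ∃ w ∈ A (x t), x' t = -w + f t)
    (hdom : (A (x 0)).Nonempty) :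
    ∀ t ∈ Ico (0 : ℝ) T,
      ∃ fplus p : EuclideanSpace ℝ (Fin n),
        -- the limit f(t⁺) of the right averages of f exists
        Tendsto (fun h : ℝ => h⁻¹ • ∫ s in t..(t + h), f s)
          (𝓝[>] (0 : ℝ)) (𝓝 fplus) ∧
        -- p is the unique nearest point to f(t⁺) in A(x(t))
        p ∈ A (x t) ∧
        (∀ q ∈ A (x t), ‖p - fplus‖ ≤ ‖q - fplus‖) ∧
        (∀ q ∈ A (x t), (∀ q' ∈ A (x t), ‖q - fplus‖ ≤ ‖q' - fplus‖) → q = p) ∧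
        -- x is right differentiable at t with right derivative f(t⁺) - p
        Tendsto (fun h : ℝ => h⁻¹ • (x (t + h) - x t))
          (𝓝[>] (0 : ℝ)) (𝓝 (fplus - p)) := by
  have hT0 : (0 : ℝ) ≤ T := hT.le
  have h0I : (0 : ℝ) ∈ Icc 0 T := ⟨le_rfl, hT0⟩
  have hfi := br_f_integrable hT0 hf
  have hac : BrACOn x x' 0 T := by
    refine ⟨hx'int, fun s hs t ht => ?_⟩
    rw [hxAC t ht, hxAC s hs, add_sub_add_left_eq_sub,
      intervalIntegral.integral_interval_sub_left (br_intInt_sub hx'int h0I ht)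
        (br_intInt_sub hx'int h0I hs)]
  have hright : ∀ t ∈ Ico (0 : ℝ) T, ∃ c, Tendsto f (𝓝[>] t) (𝓝 c) := by
    intro t ht
    obtain ⟨c, hc⟩ := hf.exists_tendsto_right t
    refine ⟨c, ?_⟩
    rw [← nhdsWithin_Ioc_eq_nhdsGT ht.2]
    refine hc.mono_left (nhdsWithin_mono _ fun s hs => ?_)
    exact ⟨⟨ht.1.trans hs.1.le, hs.2⟩, hs.1⟩
  -- estimate of the difference quotient by an average
  have hquot : ∀ t ∈ Ico (0 : ℝ) T, ∀ v ∈ A (x t), ∀ h ∈ Ioc 0 (T - t),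
      ‖h⁻¹ • (x (t + h) - x t)‖ ≤ h⁻¹ • ∫ r in t..(t + h), ‖f r - v‖ := by
    intro t ht v hv h hh
    have := br_step1 hA hfi hac hincl (s := t) (t := t + h) ⟨ht.1, ht.2.le⟩
      ⟨by linarith [ht.1, hh.1], by linarith [hh.2]⟩ (by linarith [hh.1]) hv
    rw [norm_smul, norm_inv, Real.norm_of_nonneg hh.1.le, smul_eq_mul]
    exact mul_le_mul_of_nonneg_left this (inv_nonneg.2 hh.1.le)
  have hmem : ∀ t ∈ Ico (0 : ℝ) T, ∀ᶠ h in 𝓝[>] (0 : ℝ), h ∈ Ioc 0 (T - t) :=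
    fun t ht => Ioc_mem_nhdsGT (by linarith [ht.2])
  have havg : ∀ t ∈ Ico (0 : ℝ) T, ∀ c v, Tendsto f (𝓝[>] t) (𝓝 c) →
      Tendsto (fun h : ℝ => h⁻¹ • ∫ r in t..(t + h), ‖f r - v‖) (𝓝[>] (0 : ℝ)) (𝓝 ‖c - v‖) := by
    intro t ht c v hc
    exact br_average ht.2
      ((br_intInt_sub hfi ⟨ht.1, ht.2.le⟩ ⟨hT0, le_rfl⟩).sub intervalIntegrable_const).norm
      (hc.sub_const v).norm
  obtain ⟨v0, hv0⟩ := hdom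
  have h0 : (0 : ℝ) ∈ Ico 0 T := ⟨le_rfl, hT⟩
  obtain ⟨c0, hc0⟩ := hright 0 h0
  intro t ht
  obtain ⟨c, hc⟩ := hright t ht
  -- boundedness of the difference quotients at `t`
  have hbd : ∀ᶠ h in 𝓝[>] (0 : ℝ), ‖h⁻¹ • (x (t + h) - x t)‖ ≤
      (‖c0 - v0‖ + 1) + (eVariationOn f (Icc 0 T)).toReal := by
    have hev := (havg 0 h0 c0 v0 hc0).eventually_le_const (lt_add_one ‖c0 - v0‖)
    filter_upwards [hev, hmem t ht, hmem 0 h0] with h h1 h2 h3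
    have h4 := (hquot 0 h0 v0 hv0 h h3).trans h1
    have h5 := br_step2 hA hf hac hincl ht.1 h2.1.le (by linarith [h2.2])
    rw [zero_add, norm_smul, norm_inv, Real.norm_of_nonneg h2.1.le] at h4
    rw [norm_smul, norm_inv, Real.norm_of_nonneg h2.1.le]
    have h6 := mul_le_mul_of_nonneg_left h5 (inv_nonneg.2 h2.1.le)
    rw [mul_add, inv_mul_cancel_left₀ h2.1.ne'] at h6
    linarith
  have hne : (A (x t)).Nonempty := by
    have hU : ((Ultrafilter.of (𝓝[>] (0 : ℝ)) : Ultrafilter ℝ) : Filter ℝ) ≤ 𝓝[>] (0 : ℝ) :=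
      Ultrafilter.of_le _
    obtain ⟨d, hd⟩ := br_ultra hbd _ hU
    exact ⟨_, br_limit_mem hA hfi hac hincl ht hc hU hd⟩
  obtain ⟨p, hp, hmin, huniq⟩ := br_proj (br_convex hA (x t)) (br_closed hA (x t)) hne c
  refine ⟨c, p, br_average ht.2 (br_intInt_sub hfi ⟨ht.1, ht.2.le⟩ ⟨hT0, le_rfl⟩) hc, hp, hmin,
    fun q hq h => huniq q hq (h p hp), ?_⟩
  rw [tendsto_iff_ultrafilter]
  intro U hU
  obtain ⟨d, hd⟩ := br_ultra hbd U hU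
  have hdA := br_limit_mem hA hfi hac hincl ht hc hU hd
  have hdn : ‖d‖ ≤ ‖c - p‖ := by
    refine le_of_tendsto_of_tendsto hd.norm ((havg t ht c p hc).mono_left hU) ?_
    filter_upwards [hU (hmem t ht)] with h hh
    exact hquot t ht p hp h hh
  have hcd : c - d = p := by
    refine huniq _ hdA ?_
    rw [norm_sub_rev p c]
    simpa using hdn
  have : c - p = d := by rw [← hcd]; abel
  rw [this]
  exact hd
end
end

section
/- (Regularity of feasible trajectories, part (i).) Assume (H1), (H2), (H4), (H5), let C be the convex polyhedron C = ⋂_{j=1}^s {x ∈ ℝ^n : ⟨x*_j, x⟩ ≤ c_j} with ‖x*_j‖ = 1, and let (x̄, ū) be a feasible pair for (DMP) such that ū : [0,T] → U has bounded variation and is right continuous on [0,T). Then x̄ is Lipschitz continuous on [0,T] and right differentiable at every t ∈ [0,T). -/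
open MeasureTheory Set Filter
open scoped RealInnerProductSpace Topology

noncomputable section

/-- The normal cone of convex analysis to `C` at `x` (empty when `x ∉ C`). -/
def convNormalCone {n : ℕ} (C : Set (EuclideanSpace ℝ (Fin n)))
    (x : EuclideanSpace ℝ (Fin n)) : Set (EuclideanSpace ℝ (Fin n)) :=
  {v | x ∈ C ∧ ∀ y ∈ C, ⟪v, y - x⟫ ≤ 0}

/-- A feasible pair `(x, u)` (with velocity `x'`) for the time-delayed sweeping
control system (DMP). -/
def FeasiblePair {n d : ℕ} (T Δ : ℝ) (C : Set (EuclideanSpace ℝ (Fin n)))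
    (U : Set (EuclideanSpace ℝ (Fin d)))
    (g : ℝ → EuclideanSpace ℝ (Fin n) → EuclideanSpace ℝ (Fin n) →
      EuclideanSpace ℝ (Fin d) → EuclideanSpace ℝ (Fin n))
    (δ : ℝ → ℝ) (φ : ℝ → EuclideanSpace ℝ (Fin n))
    (x x' : ℝ → EuclideanSpace ℝ (Fin n))
    (u : ℝ → EuclideanSpace ℝ (Fin d)) : Prop :=
  Measurable u ∧ (∀ t ∈ Icc (0 : ℝ) T, u t ∈ U) ∧
  IntervalIntegrable x' volume 0 T ∧
  (∀ t ∈ Icc (0 : ℝ) T, x t = x 0 + ∫ s in (0 : ℝ)..t, x' s) ∧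
  (∀ s ∈ Icc (-Δ) (0 : ℝ), x s = φ s) ∧
  (∀ t ∈ Icc (0 : ℝ) T, x t ∈ C) ∧
  (∀ᵐ t ∂volume, t ∈ Icc (0 : ℝ) T →
    -x' t - g t (x t) (x (t - δ t)) (u t) ∈ convNormalCone C (x t))

theorem aux_deriv {n : ℕ} {T : ℝ} (hT : 0 < T) {x x' : ℝ → EuclideanSpace ℝ (Fin n)}
    (hint : IntervalIntegrable x' volume 0 T)
    (hx : ∀ t ∈ Icc (0 : ℝ) T, x t = x 0 + ∫ s in (0 : ℝ)..t, x' s) :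
    ∀ᵐ t ∂volume, t ∈ Ioo (0 : ℝ) T → HasDerivAt x (x' t) t := by
  filter_upwards [hint.ae_hasDerivAt_integral] with t ht htI
  have h0 : (0 : ℝ) ∈ uIcc 0 T := by simp
  have h1 : t ∈ uIcc 0 T := by rw [uIcc_of_le hT.le]; exact Ioo_subset_Icc_self htI
  have h2 := (ht h1 0 h0).const_add (x 0)
  refine h2.congr_of_eventuallyEq ?_
  filter_upwards [Ioo_mem_nhds htI.1 htI.2] with τ hτ
  exact hx τ (Ioo_subset_Icc_self hτ)

theorem aux_norm {n : ℕ} {C : Set (EuclideanSpace ℝ (Fin n))} {x : ℝ → EuclideanSpace ℝ (Fin n)}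
    {v f : EuclideanSpace ℝ (Fin n)} {t : ℝ} (hd : HasDerivAt x v t)
    (hC : ∀ᶠ τ in 𝓝 t, x τ ∈ C) (hN : f - v ∈ convNormalCone C (x t)) : ‖v‖ ≤ ‖f‖ := by
  have hmax : IsLocalMax (fun τ => ⟪f - v, x τ⟫) t := by
    filter_upwards [hC] with τ hτ
    have := hN.2 _ hτ
    rw [inner_sub_right] at this
    linarith
  have hder : HasDerivAt (fun τ => ⟪f - v, x τ⟫) ⟪f - v, v⟫ t := by
    simpa using (hasDerivAt_const t (f - v)).inner ℝ hd
  have h0 := hmax.hasDerivAt_eq_zero hder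
  rw [inner_sub_left, real_inner_self_eq_norm_sq] at h0
  have h1 := real_inner_le_norm f v
  by_contra! hlt
  nlinarith [norm_nonneg f, norm_nonneg v]

theorem aux_lip {n : ℕ} {T M : ℝ} (hT : 0 < T) {C : Set (EuclideanSpace ℝ (Fin n))}
    {x x' f : ℝ → EuclideanSpace ℝ (Fin n)}
    (hint : IntervalIntegrable x' volume 0 T)
    (hx : ∀ t ∈ Icc (0 : ℝ) T, x t = x 0 + ∫ s in (0 : ℝ)..t, x' s)
    (hC : ∀ t ∈ Icc (0 : ℝ) T, x t ∈ C)
    (hN : ∀ᵐ t ∂volume, t ∈ Icc (0 : ℝ) T → f t - x' t ∈ convNormalCone C (x t))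
    (hM : ∀ t ∈ Icc (0 : ℝ) T, ‖f t‖ ≤ M) :
    ∃ L : NNReal, LipschitzOnWith L x (Icc 0 T) := by
  have hb : ∀ᵐ t ∂volume, t ∈ Ioo (0 : ℝ) T → ‖x' t‖ ≤ M := by
    filter_upwards [aux_deriv hT hint hx, hN] with t hd hn ht
    refine (aux_norm (hd ht) ?_ (hn (Ioo_subset_Icc_self ht))).trans (hM t (Ioo_subset_Icc_self ht))
    filter_upwards [Ioo_mem_nhds ht.1 ht.2] with τ hτ using hC τ (Ioo_subset_Icc_self hτ)
  have hM0 : 0 ≤ M := (norm_nonneg _).trans (hM 0 ⟨le_rfl, hT.le⟩)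
  have hne : ∀ᵐ t ∂(volume : Measure ℝ), t ≠ T := by simp [ae_iff, measure_singleton]
  refine ⟨⟨M, hM0⟩, LipschitzOnWith.of_dist_le_mul fun p hp q hq => ?_⟩
  have hsub : ∀ r ∈ Icc (0 : ℝ) T, IntervalIntegrable x' volume 0 r := fun r hr =>
    hint.mono_set (by rw [uIcc_of_le hT.le, uIcc_of_le hr.1]; exact Icc_subset_Icc le_rfl hr.2)
  have hdiff : x p - x q = ∫ s in q..p, x' s := by
    rw [hx p hp, hx q hq, add_sub_add_left_eq_sub,
      intervalIntegral.integral_interval_sub_left (hsub p hp) (hsub q hq)]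
  rw [dist_eq_norm, hdiff, Real.dist_eq]
  refine intervalIntegral.norm_integral_le_of_norm_le_const_ae ?_
  filter_upwards [hb, hne] with t ht htT hti
  refine ht ⟨(le_min hq.1 hp.1).trans_lt hti.1, lt_of_le_of_ne (hti.2.trans (max_le hq.2 hp.2)) htT⟩

theorem aux_compare {n : ℕ} {T t0 t1 ε : ℝ} (ht0 : 0 ≤ t0) (h01 : t0 < t1) (h1T : t1 ≤ T)
    {C : Set (EuclideanSpace ℝ (Fin n))}
    {x x' f : ℝ → EuclideanSpace ℝ (Fin n)} {w f0 : EuclideanSpace ℝ (Fin n)} {L : NNReal}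
    (hint : IntervalIntegrable x' volume 0 T)
    (hx : ∀ t ∈ Icc (0 : ℝ) T, x t = x 0 + ∫ s in (0 : ℝ)..t, x' s)
    (hN : ∀ᵐ t ∂volume, t ∈ Icc (0 : ℝ) T → f t - x' t ∈ convNormalCone C (x t))
    (hL : LipschitzOnWith L x (Icc 0 T))
    (hy : ∀ t ∈ Ioo t0 t1, f0 - w ∈ convNormalCone C (x t0 + (t - t0) • w))
    (hf : ∀ t ∈ Ioo t0 t1, ‖f t - f0‖ ≤ ε) :
    ‖x t1 - (x t0 + (t1 - t0) • w)‖ ≤ 2 * ε * (t1 - t0) := by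
  set z : ℝ → EuclideanSpace ℝ (Fin n) := fun t => x t - (x t0 + (t - t0) • w) with hz
  have hT : 0 < T := by linarith
  have hε : 0 ≤ ε := (norm_nonneg _).trans (hf ((t0 + t1) / 2) ⟨by linarith, by linarith⟩)
  have hzL : LipschitzOnWith (L + ‖w‖₊) z (Icc 0 T) := by
    refine LipschitzOnWith.of_dist_le_mul fun p hp q hq => ?_
    have h1 := hL.dist_le_mul p hp q hq
    have e : z p - z q = (x p - x q) - (p - q) • w := by simp only [hz]; module
    rw [dist_eq_norm] at h1 ⊢
    rw [e]
    refine (norm_sub_le _ _).trans ?_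
    rw [norm_smul, Real.dist_eq] at *
    rw [Real.norm_eq_abs]
    push_cast
    linarith
  have hzc : ContinuousOn z (Icc 0 T) := hzL.continuousOn
  have hzt0 : z t0 = 0 := by simp [hz]
  -- the maximum point
  obtain ⟨m, hm, hmax⟩ := isCompact_Icc.exists_isMaxOn (nonempty_Icc.2 h01.le)
    ((hzc.mono (Icc_subset_Icc ht0 h1T)).norm)
  have hsubm : Icc t0 m ⊆ Icc 0 T := Icc_subset_Icc ht0 (hm.2.trans h1T)
  have hac : AbsolutelyContinuousOnInterval (fun t => ‖z t‖) t0 m := by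
    refine LipschitzOnWith.absolutelyContinuousOnInterval (K := L + ‖w‖₊) ?_
    rw [uIcc_of_le hm.1]
    refine LipschitzOnWith.of_dist_le_mul fun p hp q hq => ?_
    refine le_trans ?_ (hzL.dist_le_mul p (hsubm hp) q (hsubm hq))
    rw [dist_eq_norm (z p)]
    exact abs_norm_sub_norm_le _ _
  have hac2 := hac.fun_mul hac
  have hftc := hac2.integral_deriv_eq_sub
  have hneT : ∀ᵐ t ∂(volume : Measure ℝ), t ≠ m := by simp [ae_iff, measure_singleton]
  have hne0 : ∀ᵐ t ∂(volume : Measure ℝ), t ≠ t0 := by simp [ae_iff, measure_singleton]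
  have hle : ∫ t in t0..m, deriv (fun t => ‖z t‖ * ‖z t‖) t ≤ ∫ t in t0..m, (2 * ε * ‖z m‖) := by
    refine intervalIntegral.integral_mono_ae_restrict hm.1 hac2.intervalIntegrable_deriv
      intervalIntegrable_const ?_
    refine (ae_restrict_iff' measurableSet_Icc).2 ?_
    filter_upwards [aux_deriv hT hint hx, hN, hneT, hne0] with t hd hn htm htt0 htI
    have htlt : t0 < t := lt_of_le_of_ne htI.1 (Ne.symm htt0)
    have htlm : t < m := lt_of_le_of_ne htI.2 htm
    have hto : t ∈ Ioo t0 t1 := ⟨htlt, htlm.trans_le hm.2⟩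
    have hdx := hd ⟨by linarith, by linarith [hm.2]⟩
    have hdz : HasDerivAt z (x' t - w) t := by
      have h1 : HasDerivAt (fun t : ℝ => x t0 + (t - t0) • w) w t := by
        simpa using (((hasDerivAt_id t).sub_const t0).smul_const w).const_add (x t0)
      exact hdx.sub h1
    have hdn : HasDerivAt (fun t => ‖z t‖ * ‖z t‖) (2 * ⟪z t, x' t - w⟫) t := by
      simpa [pow_two] using hdz.norm_sq
    rw [hdn.deriv]
    have hnx := hn (hsubm htI)
    have hny := hy t hto
    have i1 := hnx.2 _ hny.1
    have i2 := hny.2 _ hnx.1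
    have e1 : x t0 + (t - t0) • w - x t = -z t := by simp [hz]
    have e2 : x t - (x t0 + (t - t0) • w) = z t := rfl
    rw [e1, inner_neg_right] at i1
    rw [e2] at i2
    have i3 : ⟪f t - f0, z t⟫ ≤ ε * ‖z m‖ := by
      refine (real_inner_le_norm _ _).trans ?_
      exact mul_le_mul (hf t hto) (hmax ⟨htI.1, htI.2.trans hm.2⟩) (norm_nonneg _) hε
    have e3 : ⟪z t, x' t - w⟫ = ⟪f t - f0, z t⟫ - ⟪f t - x' t, z t⟫ + ⟪f0 - w, z t⟫ := by
      rw [real_inner_comm, ← inner_sub_left, ← inner_add_left]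
      congr 1
      abel
    rw [e3]
    linarith
  rw [hftc, intervalIntegral.integral_const, hzt0, smul_eq_mul] at hle
  simp only [norm_zero, mul_zero, sub_zero] at hle
  have hzm : ‖z m‖ ≤ 2 * ε * (m - t0) := by
    by_contra! hlt
    have : 0 ≤ 2 * ε * (m - t0) := mul_nonneg (by linarith) (by linarith [hm.1])
    nlinarith [norm_nonneg (z m)]
  have h1 : ‖z t1‖ ≤ ‖z m‖ := hmax (right_mem_Icc.2 h01.le)
  refine h1.trans (hzm.trans ?_)
  have := hm.2
  gcongr

theorem aux_proj {n s : ℕ} (a : Fin s → EuclideanSpace ℝ (Fin n)) (c : Fin s → ℝ)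
    (C : Set (EuclideanSpace ℝ (Fin n)))
    (hC : C = ⋂ j : Fin s, {x : EuclideanSpace ℝ (Fin n) | ⟪a j, x⟫ ≤ c j})
    {x0 : EuclideanSpace ℝ (Fin n)} (hx0 : x0 ∈ C) (f0 : EuclideanSpace ℝ (Fin n)) :
    ∃ w : EuclideanSpace ℝ (Fin n), ∀ᶠ h in 𝓝[>] (0 : ℝ),
      f0 - w ∈ convNormalCone C (x0 + h • w) := by
  have hmem : ∀ y, y ∈ C ↔ ∀ j, ⟪a j, y⟫ ≤ c j := by intro y; rw [hC]; simp
  let K : Set (EuclideanSpace ℝ (Fin n)) := {v | ∀ j, ⟪a j, x0⟫ = c j → ⟪a j, v⟫ ≤ 0}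
  have hKc : IsClosed K := by
    have : K = ⋂ j, ⋂ (_ : ⟪a j, x0⟫ = c j), {v | ⟪a j, v⟫ ≤ 0} := by
      ext v; simp [K]
    rw [this]
    refine isClosed_iInter fun j => isClosed_iInter fun _ => ?_
    exact isClosed_le (by fun_prop) continuous_const
  have hKconv : Convex ℝ K := by
    intro p hp q hq α β hα hβ _ j hj
    rw [inner_add_right, inner_smul_right, inner_smul_right]
    nlinarith [mul_nonneg hα (neg_nonneg.2 (hp j hj)), mul_nonneg hβ (neg_nonneg.2 (hq j hj))]
  have hK0 : (0 : EuclideanSpace ℝ (Fin n)) ∈ K := fun j _ => by simp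
  obtain ⟨w, hwK, hw⟩ := exists_norm_eq_iInf_of_complete_convex ⟨0, hK0⟩ hKc.isComplete hKconv f0
  rw [norm_eq_iInf_iff_real_inner_le_zero hKconv hwK] at hw
  have hw0 : ⟪f0 - w, w⟫ = 0 := by
    have h1 := hw 0 hK0
    have h2 := hw ((2 : ℝ) • w) (fun j hj => by
      rw [inner_smul_right]; nlinarith [hwK j hj])
    rw [zero_sub, inner_neg_right] at h1
    rw [two_smul, add_sub_cancel_right] at h2
    linarith
  refine ⟨w, ?_⟩
  have hin : ∀ᶠ h in 𝓝[>] (0 : ℝ), ∀ j, ⟪a j, x0 + h • w⟫ ≤ c j := by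
    rw [eventually_all]
    intro j
    rcases eq_or_lt_of_le ((hmem x0).1 hx0 j) with hj | hj
    · filter_upwards [self_mem_nhdsWithin] with h hh
      rw [inner_add_right, inner_smul_right, hj]
      nlinarith [hwK j hj, mem_Ioi.1 hh]
    · have hcont : Continuous fun h : ℝ => ⟪a j, x0 + h • w⟫ := by fun_prop
      have : Tendsto (fun h : ℝ => ⟪a j, x0 + h • w⟫) (𝓝[>] 0) (𝓝 ⟪a j, x0⟫) := by
        have := (hcont.tendsto 0).mono_left (nhdsWithin_le_nhds (s := Ioi (0 : ℝ)))
        simpa using this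
      exact (this.eventually (gt_mem_nhds hj)).mono fun _ h => le_of_lt h
  filter_upwards [hin] with h hh
  refine ⟨(hmem _).2 hh, fun y hy => ?_⟩
  have h1 := hw (y - x0) (fun j hj => by
    rw [inner_sub_right, hj]; linarith [(hmem y).1 hy j])
  rw [inner_sub_right, hw0] at h1
  rw [← sub_sub, inner_sub_right, inner_smul_right, hw0]
  linarith

theorem aux_right {n s : ℕ} {T : ℝ} (a : Fin s → EuclideanSpace ℝ (Fin n)) (c : Fin s → ℝ)
    (C : Set (EuclideanSpace ℝ (Fin n)))
    (hCdef : C = ⋂ j : Fin s, {x : EuclideanSpace ℝ (Fin n) | ⟪a j, x⟫ ≤ c j})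
    {x x' f : ℝ → EuclideanSpace ℝ (Fin n)} {L : NNReal}
    (hint : IntervalIntegrable x' volume 0 T)
    (hx : ∀ t ∈ Icc (0 : ℝ) T, x t = x 0 + ∫ s in (0 : ℝ)..t, x' s)
    (hC : ∀ t ∈ Icc (0 : ℝ) T, x t ∈ C)
    (hN : ∀ᵐ t ∂volume, t ∈ Icc (0 : ℝ) T → f t - x' t ∈ convNormalCone C (x t))
    (hL : LipschitzOnWith L x (Icc 0 T)) {t : ℝ} (ht : t ∈ Ico 0 T)
    (hf : Tendsto f (𝓝[>] t) (𝓝 (f t))) :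
    ∃ w : EuclideanSpace ℝ (Fin n),
      Tendsto (fun h : ℝ => h⁻¹ • (x (t + h) - x t)) (𝓝[>] (0 : ℝ)) (𝓝 w) := by
  obtain ⟨w, hw⟩ := aux_proj a c C hCdef (hC t (Ico_subset_Icc_self ht)) (f t)
  refine ⟨w, ?_⟩
  rw [Metric.tendsto_nhds]
  intro ε hε
  have hf' := (Metric.tendsto_nhds.1 hf) (ε / 4) (by linarith)
  obtain ⟨η, hη, hηs⟩ := (mem_nhdsGT_iff_exists_Ioo_subset).1 hw
  obtain ⟨μ, hμ, hμs⟩ := (mem_nhdsGT_iff_exists_Ioo_subset).1 hf'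
  rw [mem_Ioi] at hη hμ
  have hpos : 0 < min (min η (μ - t)) (T - t) := by
    refine lt_min (lt_min hη (by linarith)) (by linarith [ht.2])
  filter_upwards [Ioo_mem_nhdsGT hpos] with h hh
  obtain ⟨h0, h1⟩ := hh
  have h2 := h1.trans_le (min_le_right _ _)
  have h3 := h1.trans_le (min_le_left _ _)
  have h4 := h3.trans_le (min_le_right _ _)
  have h5 := h3.trans_le (min_le_left _ _)
  have key := aux_compare (t0 := t) (t1 := t + h) (ε := ε / 4) (w := w) (f0 := f t) ht.1
    (by linarith) (by linarith) hint hx hN hL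
    (fun τ hτ => hηs ⟨by linarith [hτ.1], by linarith [hτ.2]⟩)
    (fun τ hτ => by
      have : dist (f τ) (f t) < ε / 4 := hμs ⟨hτ.1, by linarith [hτ.2]⟩
      rw [dist_eq_norm] at this
      exact this.le)
  rw [add_sub_cancel_left] at key
  have e : h⁻¹ • (x (t + h) - x t) - w = h⁻¹ • (x (t + h) - (x t + h • w)) := by
    rw [← sub_sub, smul_sub _ (x (t + h) - x t), smul_smul, inv_mul_cancel₀ h0.ne', one_smul]
  rw [dist_eq_norm, e, norm_smul, norm_inv, Real.norm_eq_abs, abs_of_pos h0]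
  calc h⁻¹ * ‖x (t + h) - (x t + h • w)‖ ≤ h⁻¹ * (2 * (ε / 4) * h) := by gcongr
    _ = ε / 2 := by field_simp; ring
    _ < ε := by linarith


/-- regularity of feasible trajectories, part (i): a feasible
trajectory corresponding to a BV right-continuous control is Lipschitz on
`[0,T]` and right differentiable at every `t ∈ [0,T)`. -/
theorem stmt6 {n d : ℕ} (s : ℕ) (T Δ : ℝ) (hT : 0 < T)
    (a : Fin s → EuclideanSpace ℝ (Fin n)) (c : Fin s → ℝ)
    (ha : ∀ j, ‖a j‖ = 1)
    (C : Set (EuclideanSpace ℝ (Fin n)))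
    (hC : C = ⋂ j : Fin s, {x : EuclideanSpace ℝ (Fin n) | ⟪a j, x⟫ ≤ c j})
    (U : Set (EuclideanSpace ℝ (Fin d)))
    (g : ℝ → EuclideanSpace ℝ (Fin n) → EuclideanSpace ℝ (Fin n) →
      EuclideanSpace ℝ (Fin d) → EuclideanSpace ℝ (Fin n))
    (δ : ℝ → ℝ) (φ : ℝ → EuclideanSpace ℝ (Fin n))
    -- (H1)
    (hU : U.Nonempty) (hUcomp : IsCompact U)
    -- (H2)
    (hgcont : Continuous fun p : ℝ × EuclideanSpace ℝ (Fin n) ×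
      EuclideanSpace ℝ (Fin n) × EuclideanSpace ℝ (Fin d) =>
      g p.1 p.2.1 p.2.2.1 p.2.2.2)
    (hglip : ∀ B : Set (EuclideanSpace ℝ (Fin n) × EuclideanSpace ℝ (Fin n)),
      Bornology.IsBounded B → ∃ K : ℝ, 0 ≤ K ∧
        ∀ u ∈ U, ∀ t₁ ∈ Icc (0 : ℝ) T, ∀ t₂ ∈ Icc (0 : ℝ) T, ∀ p ∈ B, ∀ q ∈ B,
          ‖g t₁ p.1 p.2 u - g t₂ q.1 q.2 u‖ ≤
            K * (|t₁ - t₂| + ‖p.1 - q.1‖ + ‖p.2 - q.2‖))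
    -- (H4)
    (hδlip : ∃ K : NNReal, LipschitzOnWith K δ (Icc 0 T))
    (hδmono : AntitoneOn δ (Icc 0 T))
    (hδ0 : ∀ t ∈ Icc (0 : ℝ) T, 0 ≤ δ t)
    (hΔpos : 0 < Δ)
    (hΔub : ∀ t ∈ Icc (0 : ℝ) T, δ t ≤ Δ)
    (hΔmax : ∃ t ∈ Icc (0 : ℝ) T, δ t = Δ)
    -- (H5)
    (hφlip : ∃ K : NNReal, LipschitzOnWith K φ (Icc (-Δ) 0))
    (hφ0 : φ 0 ∈ C)
    -- the feasible pair with BV, right-continuous control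
    (xbar xbar' : ℝ → EuclideanSpace ℝ (Fin n))
    (ubar : ℝ → EuclideanSpace ℝ (Fin d))
    (hfeas : FeasiblePair T Δ C U g δ φ xbar xbar' ubar)
    (hBV : BoundedVariationOn ubar (Icc 0 T))
    (hrc : ∀ t ∈ Ico (0 : ℝ) T, Tendsto ubar (𝓝[>] t) (𝓝 (ubar t))) :
    (∃ L : NNReal, LipschitzOnWith L xbar (Icc 0 T)) ∧
    (∀ t ∈ Ico (0 : ℝ) T, ∃ w : EuclideanSpace ℝ (Fin n),
      Tendsto (fun h : ℝ => h⁻¹ • (xbar (t + h) - xbar t))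
        (𝓝[>] (0 : ℝ)) (𝓝 w)) := by
  obtain ⟨-, huU, hint, hx, hφ, hxC, hN⟩ := hfeas
  obtain ⟨Kδ, hKδ⟩ := hδlip
  obtain ⟨Kφ, hKφ⟩ := hφlip
  have hxc0 : ContinuousOn xbar (Icc 0 T) := by
    have h1 := intervalIntegral.continuousOn_primitive_interval' hint (left_mem_uIcc)
    rw [uIcc_of_le hT.le] at h1
    exact (continuousOn_const.add h1).congr hx
  have hxc1 : ContinuousOn xbar (Icc (-Δ) 0) := hKφ.continuousOn.congr hφ
  have hxc : ContinuousOn xbar (Icc (-Δ) T) := by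
    have := hxc1.union_of_isClosed hxc0 isClosed_Icc isClosed_Icc
    rwa [Icc_union_Icc_eq_Icc (by linarith) hT.le] at this
  have hmaps : MapsTo (fun t => t - δ t) (Icc 0 T) (Icc (-Δ) T) := fun t ht =>
    ⟨by linarith [ht.1, hΔub t ht], by linarith [ht.2, hδ0 t ht]⟩
  have hyc : ContinuousOn (fun t => xbar (t - δ t)) (Icc 0 T) :=
    hxc.comp (continuousOn_id.sub hKδ.continuousOn) hmaps
  set f : ℝ → EuclideanSpace ℝ (Fin n) :=
    fun t => -g t (xbar t) (xbar (t - δ t)) (ubar t) with hf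
  have hN' : ∀ᵐ t ∂volume, t ∈ Icc (0 : ℝ) T → f t - xbar' t ∈ convNormalCone C (xbar t) := by
    filter_upwards [hN] with t ht htI
    have e : f t - xbar' t = -xbar' t - g t (xbar t) (xbar (t - δ t)) (ubar t) := by
      simp only [hf]; abel
    rw [e]; exact ht htI
  have hM : ∃ M, ∀ t ∈ Icc (0 : ℝ) T, ‖f t‖ ≤ M := by
    have hcomp : IsCompact ((Icc (0 : ℝ) T) ×ˢ ((xbar '' Icc 0 T) ×ˢ
        (((fun t => xbar (t - δ t)) '' Icc 0 T) ×ˢ U))) :=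
      isCompact_Icc.prod ((isCompact_Icc.image_of_continuousOn hxc0).prod
        ((isCompact_Icc.image_of_continuousOn hyc).prod hUcomp))
    obtain ⟨M, hM⟩ := hcomp.exists_bound_of_continuousOn hgcont.continuousOn
    refine ⟨M, fun t ht => ?_⟩
    have := hM (t, xbar t, xbar (t - δ t), ubar t)
      ⟨ht, mem_image_of_mem _ ht, mem_image_of_mem _ ht, huU t ht⟩
    simpa [hf] using this
  obtain ⟨M, hM⟩ := hM
  obtain ⟨L, hL⟩ := aux_lip hT hint hx hxC hN' hM
  refine ⟨⟨L, hL⟩, fun t ht => ?_⟩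
  refine aux_right a c C hC hint hx hxC hN' hL ht ?_
  have hle : 𝓝[>] t ≤ 𝓝[Icc 0 T] t := by
    refine nhdsWithin_le_of_mem ?_
    filter_upwards [Ioo_mem_nhdsGT ht.2] with τ hτ
    exact ⟨ht.1.trans hτ.1.le, hτ.2.le⟩
  have htI := Ico_subset_Icc_self ht
  have l1 : Tendsto (fun τ : ℝ => τ) (𝓝[>] t) (𝓝 t) := nhdsWithin_le_nhds
  have l2 := ((hxc0 t htI).tendsto).mono_left hle
  have l3 := ((hyc t htI).tendsto).mono_left hle
  have l4 := hrc t ht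
  have l5 := l1.prodMk_nhds (l2.prodMk_nhds (l3.prodMk_nhds l4))
  exact ((hgcont.tendsto _).comp l5).neg
end
end
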